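/- Let n be a positive integer, D ⊆ ℝ^n a measurable set, f : D → ℝ a measurable function, and k a nonnegative integer. Then the following are equivalent: (1) for almost every x₀ ∈ D there exists a polynomial function p : ℝ^n → ℝ of degree at most k such that f is approximately differentiable of order k at x₀ with polynomial p; (2) for every ε > 0 there exists a function u : ℝ^n → ℝ of class C^k such that vol{x ∈ D : u(x) ≠ f(x)} < ε. (This is the paper's main Theorem 1.1 specialized to the abelian Carnot group ℝ^n, where the Carnot–Carathéodory distance is the Euclidean distance and homogeneous degree equals degree.) -/

import Mathlib

open MeasureTheory Metric Filter

noncomputable section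

/-- `ℝ^n` with the Euclidean norm. -/
abbrev Euc (n : ℕ) := EuclideanSpace ℝ (Fin n)

/-- A set `S ⊆ ℝ^n` has density one at `x` if
`vol(S ∩ B(x,r))/vol(B(x,r)) → 1` as `r → 0⁺`. -/
def DensityOneAt {n : ℕ} (S : Set (Euc n)) (x : Euc n) : Prop :=
  Tendsto (fun r : ℝ => volume (S ∩ ball x r) / volume (ball x r))
    (nhdsWithin 0 (Set.Ioi 0)) (nhds 1)

/-- A set has density zero at `x` if its complement has density one at `x`. -/
def DensityZeroAt {n : ℕ} (S : Set (Euc n)) (x : Euc n) : Prop :=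
  DensityOneAt Sᶜ x

/-- Degree `|J|` of a multi-index. -/
def mdeg {n : ℕ} (J : Fin n → ℕ) : ℕ := ∑ i, J i

/-- Monomial `x^J = x₁^{j₁} ⋯ xₙ^{jₙ}`. -/
def mpow {n : ℕ} (x : Euc n) (J : Fin n → ℕ) : ℝ := ∏ i, (x i) ^ (J i)

/-- `J! = j₁! ⋯ jₙ!`. -/
def Jfact {n : ℕ} (J : Fin n → ℕ) : ℕ := ∏ i, Nat.factorial (J i)

/-- `p : ℝ^n → ℝ` is a polynomial function of (total) degree at most `k`. -/
def IsPolyFun (n k : ℕ) (p : Euc n → ℝ) : Prop :=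
  ∃ P : MvPolynomial (Fin n) ℝ, P.totalDegree ≤ k ∧
    ∀ x : Euc n, p x = MvPolynomial.eval (fun i => x i) P

/-- `f : D → ℝ` is approximately differentiable of order `k` at `x₀` (a density point
of `D`) with polynomial `p`: `p` has degree at most `k` and for every `ε > 0` the set
`{x ∈ D : |f x − p x| > ε ‖x − x₀‖^k}` has density zero at `x₀`. -/
def ApproxDiffAt {n : ℕ} (k : ℕ) (D : Set (Euc n)) (f : Euc n → ℝ)
    (x₀ : Euc n) (p : Euc n → ℝ) : Prop :=
  DensityOneAt D x₀ ∧ IsPolyFun n k p ∧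
    ∀ ε : ℝ, 0 < ε →
      DensityZeroAt {x | x ∈ D ∧ ε * ‖x - x₀‖ ^ k < |f x - p x|} x₀

/-- `f : D → ℝ` has an approximate `(k−1)`-Taylor polynomial at `x₀` (a density point
of `D`) with polynomial `p`: `p` has degree at most `k−1` and there is `M > 0` such that
`{x ∈ D : |f x − p x| > M ‖x − x₀‖^k}` has density zero at `x₀`. -/
def HasApproxTaylorAt {n : ℕ} (k : ℕ) (D : Set (Euc n)) (f : Euc n → ℝ)
    (x₀ : Euc n) (p : Euc n → ℝ) : Prop :=
  DensityOneAt D x₀ ∧ IsPolyFun n (k - 1) p ∧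
    ∃ M : ℝ, 0 < M ∧
      DensityZeroAt {x | x ∈ D ∧ M * ‖x - x₀‖ ^ k < |f x - p x|} x₀

/-- The finset of multi-indices `J` with `|J| ≤ k`. -/
def multiIdxLe (n k : ℕ) : Finset (Fin n → ℕ) :=
  (Fintype.piFinset fun _ : Fin n => Finset.range (k+1)).filter fun J => mdeg J ≤ k

/-- The finset of multi-indices `J` with `|J| < k` (i.e. `|J| ≤ k−1`). -/
def multiIdxLt (n k : ℕ) : Finset (Fin n → ℕ) :=
  (Fintype.piFinset fun _ : Fin n => Finset.range (k+1)).filter fun J => mdeg J < k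

/-- Partial derivative `∂g/∂xᵢ` (as a line derivative in the direction `eᵢ`). -/
def pd {n : ℕ} (i : Fin n) (g : Euc n → ℝ) : Euc n → ℝ :=
  fun x => lineDeriv ℝ g x (EuclideanSpace.single i 1)

/-- The list of directions `(1,…,1,2,…,2,…)` (direction `i` repeated `J i` times)
encoding the iterated partial derivative `∂^{|J|}/∂x₁^{j₁}⋯∂xₙ^{jₙ}`. -/
def multiList (n : ℕ) (J : Fin n → ℕ) : List (Fin n) :=
  (List.finRange n).flatMap fun i => List.replicate (J i) i

/-- Iterated partial derivatives along a list of coordinate directions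
(the head of the list is the outermost derivative). -/
def iterD {n : ℕ} : List (Fin n) → (Euc n → ℝ) → (Euc n → ℝ)
  | [], g => g
  | i :: L, g => pd i (iterD L g)

/-- The iterated partial derivatives along the list `L` all exist at every point. -/
def iterDExists {n : ℕ} : List (Fin n) → (Euc n → ℝ) → Prop
  | [], _ => True
  | i :: L, g => iterDExists L g ∧
      ∀ x : Euc n, LineDifferentiableAt ℝ (iterD L g) x (EuclideanSpace.single i 1)

/-- `D^J u = ∂^{|J|}u/∂x₁^{j₁}⋯∂xₙ^{jₙ}`. -/
def DJ {n : ℕ} (J : Fin n → ℕ) (u : Euc n → ℝ) : Euc n → ℝ := iterD (multiList n J) u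

/-- The Taylor polynomial of `u` of degree `k−1` centered at `x₀`:
`P_{x₀}(y) = Σ_{|I| ≤ k−1} D^I u(x₀) (y − x₀)^I / I!`. -/
def TaylorPoly {n : ℕ} (k : ℕ) (u : Euc n → ℝ) (x₀ : Euc n) : Euc n → ℝ :=
  fun y => ∑ I ∈ multiIdxLt n k, DJ I u x₀ * mpow (y - x₀) I / (Jfact I : ℝ)

/-- `u` belongs to `Lip(k, ℝ^n)` with constant `M`: all partial derivatives `D^J u`
with `|J| ≤ k−1` exist at every point, and for all such `J` and all `x, x₀`,
`|D^J u(x₀)| ≤ M` and `|D^J u(x) − D^J P_{x₀}(x)| ≤ M ‖x − x₀‖^{k−|J|}`. -/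
def MemLip (n k : ℕ) (M : ℝ) (u : Euc n → ℝ) : Prop :=
  (∀ J : Fin n → ℕ, mdeg J < k → iterDExists (multiList n J) u) ∧
  ∀ J : Fin n → ℕ, mdeg J < k → ∀ x x₀ : Euc n,
    |DJ J u x₀| ≤ M ∧
    |DJ J u x - DJ J (TaylorPoly k u x₀) x| ≤ M * ‖x - x₀‖ ^ (k - mdeg J)

/-- Truncation of `f` at level `h`: equals `f` where `−h < f < h`, equals `h` where
`f ≥ h`, and equals `−h` where `f ≤ −h`. -/
def trunc {n : ℕ} (h : ℕ) (f : Euc n → ℝ) : Euc n → ℝ :=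
  fun x => if (h : ℝ) ≤ f x then (h : ℝ) else if f x ≤ -(h : ℝ) then -(h : ℝ) else f x



/-- Scaled pointwise bound on all derivatives up to order `k`. -/
def Bd {n : ℕ} (k : ℕ) (g : Euc n → ℝ) (x : Euc n) (r M : ℝ) : Prop :=
  ∀ i : ℕ, i ≤ k → r ^ i * ‖iteratedFDeriv ℝ i g x‖ ≤ M

theorem Bd.congr {n k : ℕ} {g h : Euc n → ℝ} {x : Euc n} {r M : ℝ} (hg : Bd k g x r M)
    (e : h =ᶠ[nhds x] g) : Bd k h x r M := by
  intro i hi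
  rw [(e.iteratedFDeriv ℝ i).eq_of_nhds]
  exact hg i hi

theorem Bd.mono {n k : ℕ} {g : Euc n → ℝ} {x : Euc n} {r M M' : ℝ} (hg : Bd k g x r M)
    (e : M ≤ M') : Bd k g x r M' := fun i hi => (hg i hi).trans e

theorem Bd.mono_r {n k : ℕ} {g : Euc n → ℝ} {x : Euc n} {r r' M : ℝ} (hg : Bd k g x r M)
    (h0 : 0 ≤ r') (e : r' ≤ r) : Bd k g x r' M := fun i hi =>
  le_trans (by gcongr) (hg i hi)

theorem Bd.zero {n k : ℕ} {x : Euc n} {r M : ℝ} (hM : 0 ≤ M) :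
    Bd k (fun _ : Euc n => (0 : ℝ)) x r M := by
  intro i _
  have : iteratedFDeriv ℝ i (fun _ : Euc n => (0 : ℝ)) x = 0 := by
    simp
  rw [this]; simpa using hM

theorem Bd.add {n k : ℕ} {g h : Euc n → ℝ} {x : Euc n} {r M M' : ℝ}
    (hg' : ContDiff ℝ k g) (hh' : ContDiff ℝ k h) (hr : 0 ≤ r)
    (hg : Bd k g x r M) (hh : Bd k h x r M') : Bd k (fun y => g y + h y) x r (M + M') := by
  intro i hi
  have hi' : (i : WithTop ℕ∞) ≤ k := by exact_mod_cast hi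
  have := iteratedFDeriv_add_apply (x := x) (hg'.of_le hi').contDiffAt (hh'.of_le hi').contDiffAt
  have e : iteratedFDeriv ℝ i (fun y => g y + h y) x
      = iteratedFDeriv ℝ i g x + iteratedFDeriv ℝ i h x := this
  rw [e]
  calc r ^ i * _ ≤ r ^ i * (‖iteratedFDeriv ℝ i g x‖ + ‖iteratedFDeriv ℝ i h x‖) := by
        gcongr; exact norm_add_le _ _
    _ ≤ _ := by rw [mul_add]; exact add_le_add (hg i hi) (hh i hi)

theorem Bd.neg {n k : ℕ} {g : Euc n → ℝ} {x : Euc n} {r M : ℝ}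
    (hg : Bd k g x r M) : Bd k (fun y => - g y) x r M := by
  intro i hi
  have e : iteratedFDeriv ℝ i (fun y => - g y) x = - iteratedFDeriv ℝ i g x :=
    iteratedFDeriv_neg_apply
  rw [e, norm_neg]; exact hg i hi

theorem Bd.sub {n k : ℕ} {g h : Euc n → ℝ} {x : Euc n} {r M M' : ℝ}
    (hg' : ContDiff ℝ k g) (hh' : ContDiff ℝ k h) (hr : 0 ≤ r)
    (hg : Bd k g x r M) (hh : Bd k h x r M') : Bd k (fun y => g y - h y) x r (M + M') := by
  simpa only [sub_eq_add_neg] using hg.add hg' hh'.neg hr hh.neg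

theorem Bd.mul {n k : ℕ} {g h : Euc n → ℝ} {x : Euc n} {r M M' : ℝ}
    (hg' : ContDiff ℝ k g) (hh' : ContDiff ℝ k h) (hr : 0 ≤ r)
    (hg : Bd k g x r M) (hh : Bd k h x r M') :
    Bd k (fun y => g y * h y) x r (2 ^ k * (M * M')) := by
  have hM : 0 ≤ M := le_trans (by positivity) (hg 0 (Nat.zero_le _))
  have hM' : 0 ≤ M' := le_trans (by positivity) (hh 0 (Nat.zero_le _))
  intro i hi
  have hi' : (i : WithTop ℕ∞) ≤ k := by exact_mod_cast hi
  have := norm_iteratedFDeriv_mul_le hg' hh' x hi'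
  refine (mul_le_mul_of_nonneg_left this (by positivity)).trans ?_
  calc _ = ∑ j ∈ Finset.range (i + 1), (i.choose j : ℝ) * ((r ^ j * ‖iteratedFDeriv ℝ j g x‖) *
          (r ^ (i - j) * ‖iteratedFDeriv ℝ (i - j) h x‖)) := by
        rw [Finset.mul_sum]
        refine Finset.sum_congr rfl fun j hj => ?_
        have : r ^ i = r ^ j * r ^ (i - j) := by
          rw [← pow_add]; congr 1; have := Finset.mem_range.1 hj; omega
        rw [this]; ring
    _ ≤ ∑ j ∈ Finset.range (i + 1), (i.choose j : ℝ) * (M * M') := by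
        refine Finset.sum_le_sum fun j hj => ?_
        have := Finset.mem_range.1 hj
        gcongr
        · exact hg j (by omega)
        · exact hh (i - j) (by omega)
    _ = 2 ^ i * (M * M') := by
        rw [← Finset.sum_mul]; congr 1
        exact_mod_cast Nat.sum_range_choose i
    _ ≤ _ := by gcongr; norm_num

/-- Sum with bounded overlap. -/
theorem Bd.sum {n k : ℕ} {ι : Type*} (T : Finset ι) (T' : Finset ι) (hT : T' ⊆ T)
    {g : ι → Euc n → ℝ} {x : Euc n} {r M : ℝ}
    (hg' : ∀ t ∈ T, ContDiff ℝ k (g t)) (hr : 0 ≤ r)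
    (hg : ∀ t ∈ T', Bd k (g t) x r M)
    (h0 : ∀ t ∈ T, t ∉ T' → g t =ᶠ[nhds x] fun _ => 0) :
    Bd k (fun y => ∑ t ∈ T, g t y) x r (T'.card * M) := by
  have e : (fun y => ∑ t ∈ T, g t y) =ᶠ[nhds x] (fun y => ∑ t ∈ T', g t y) := by
    have : ∀ᶠ y in nhds x, ∀ t ∈ T, t ∉ T' → g t y = 0 := by
      rw [Filter.eventually_all_finset]
      intro t ht
      by_cases h : t ∈ T'
      · simp [h]
      · filter_upwards [h0 t ht h] with y hy _ using hy
    filter_upwards [this] with y hy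
    exact (Finset.sum_subset hT hy).symm
  refine Bd.congr ?_ e
  have hg'' : ∀ t ∈ T', ContDiff ℝ k (g t) := fun t ht => hg' t (hT ht)
  clear e h0 hT hg'
  classical
  induction T' using Finset.induction_on with
  | empty => simpa using Bd.zero le_rfl
  | insert a S ha ih =>
    simp only [Finset.sum_insert ha, Finset.card_insert_of_notMem ha]
    have h1 := ih (fun t ht => hg t (Finset.mem_insert_of_mem ht))
      (fun t ht => hg'' t (Finset.mem_insert_of_mem ht))
    have h2 := hg a (Finset.mem_insert_self _ _)
    refine (h2.add (hg'' a (Finset.mem_insert_self _ _)) (ContDiff.sum fun t ht =>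
      hg'' t (Finset.mem_insert_of_mem ht)) hr h1).mono (le_of_eq ?_)
    push_cast; ring

/-! ### Lattice partition of unity -/

def th (t : ℝ) : ℝ := Real.smoothTransition (t + 1) - Real.smoothTransition t

theorem th_zero {t : ℝ} (h : 1 ≤ |t|) : th t = 0 := by
  unfold th
  rcases le_abs'.1 h with h | h
  · rw [Real.smoothTransition.zero_of_nonpos (by linarith),
      Real.smoothTransition.zero_of_nonpos (by linarith)]; simp
  · rw [Real.smoothTransition.one_of_one_le (by linarith),
      Real.smoothTransition.one_of_one_le (by linarith)]; simp

theorem th_sum (M : ℕ) (t : ℝ) (h : |t| ≤ M) :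
    ∑ m ∈ Finset.Icc (-(M : ℤ)) M, th (t - m) = 1 := by
  have key : ∀ N : ℕ, ∑ m ∈ Finset.Icc (-(N : ℤ)) N, th (t - m) =
      Real.smoothTransition (t + N + 1) - Real.smoothTransition (t - N) := by
    intro N
    induction N with
    | zero => simp [th]
    | succ N ih =>
      have : Finset.Icc (-((N + 1 : ℕ) : ℤ)) ((N + 1 : ℕ) : ℤ) =
          insert (-((N : ℤ) + 1)) (insert ((N : ℤ) + 1) (Finset.Icc (-(N : ℤ)) N)) := by
        ext m; simp; omega
      rw [this, Finset.sum_insert (by simp; omega), Finset.sum_insert (by simp), ih]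
      simp only [th]; push_cast
      ring_nf
  rw [key]
  have := abs_le.1 h
  rw [Real.smoothTransition.one_of_one_le (by linarith),
    Real.smoothTransition.zero_of_nonpos (by linarith)]; simp

def Th {n : ℕ} (y : Euc n) : ℝ := ∏ i, th (y i)

theorem Th_contDiff {n : ℕ} (k : ℕ) : ContDiff ℝ k (Th : Euc n → ℝ) := by
  unfold Th th
  refine contDiff_prod fun i _ => ?_
  have hi : ContDiff ℝ k (fun y : Euc n => y i) := by fun_prop
  exact (Real.smoothTransition.contDiff.comp (hi.add contDiff_const)).sub
    (Real.smoothTransition.contDiff.comp hi)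

theorem norm_le_of_coord {n : ℕ} (y : Euc n) (h : ∀ i, |y i| < 1) : ‖y‖ ≤ n + 1 := by
  rw [EuclideanSpace.norm_eq]
  refine Real.sqrt_le_iff.2 ⟨by positivity, ?_⟩
  calc ∑ i, ‖y i‖ ^ 2 ≤ ∑ i : Fin n, (1 : ℝ) := Finset.sum_le_sum fun i _ => by
        have := h i
        rw [Real.norm_eq_abs]; nlinarith [abs_nonneg (y i)]
    _ = n := by simp
    _ ≤ _ := by nlinarith [(Nat.cast_nonneg n : (0 : ℝ) ≤ n)]

theorem Th_zero {n : ℕ} (y : Euc n) (h : (n : ℝ) + 1 < ‖y‖) : Th y = 0 := by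
  by_contra hne
  have : ∀ i, |y i| < 1 := by
    intro i
    by_contra hi
    exact hne (Finset.prod_eq_zero (Finset.mem_univ i) (th_zero (not_lt.1 hi)))
  linarith [norm_le_of_coord y this]

theorem Th_bound (n k : ℕ) : ∃ C : ℝ, 0 < C ∧ ∀ i ≤ k, ∀ y : Euc n,
    ‖iteratedFDeriv ℝ i (Th : Euc n → ℝ) y‖ ≤ C := by
  have h1 : ∀ i ≤ k, ∃ C : ℝ, ∀ y : Euc n, ‖iteratedFDeriv ℝ i (Th : Euc n → ℝ) y‖ ≤ C := by
    intro i hi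
    have hc : HasCompactSupport (Th : Euc n → ℝ) := by
      refine HasCompactSupport.intro (isCompact_closedBall 0 ((n : ℝ) + 1)) fun y hy => ?_
      exact Th_zero y (by simpa using hy)
    have hcont : Continuous (iteratedFDeriv ℝ i (Th : Euc n → ℝ)) :=
      (Th_contDiff k).continuous_iteratedFDeriv (by exact_mod_cast hi)
    exact hcont.bounded_above_of_compact_support (hc.iteratedFDeriv i)
  choose! C hC using h1
  refine ⟨∑ i ∈ Finset.range (k + 1), |C i| + 1, by positivity, fun i hi y => ?_⟩
  have : |C i| ≤ ∑ i ∈ Finset.range (k + 1), |C i| :=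
    Finset.single_le_sum (f := fun i => |C i|) (fun _ _ => abs_nonneg _)
      (Finset.mem_range.2 (by omega))
  linarith [hC i hi y, le_abs_self (C i)]

def latPt {n : ℕ} (h : ℝ) (m : Fin n → ℤ) : Euc n := WithLp.toLp 2 fun i => h * m i

theorem exists_pu (n k : ℕ) : ∃ C0 : ℝ, 0 < C0 ∧ ∃ N : ℕ, ∀ s : ℝ, 0 < s → ∀ R : ℝ,
    ∃ (T : Finset (Euc n)) (φ : Euc n → Euc n → ℝ), (∀ t, ContDiff ℝ k (φ t)) ∧
      (∀ t x, Bd k (φ t) x s C0) ∧ (∀ x, ‖x‖ < R → ∑ t ∈ T, φ t x = 1) ∧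
      (∀ t x, s < dist x t → φ t x = 0) ∧
      ∀ x, (T.filter (fun t => dist x t ≤ s)).card ≤ N := by
  obtain ⟨C, hC0, hC⟩ := Th_bound n k
  set l : ℝ := n + 1 with hl
  have hlpos : 0 < l := by positivity
  have hl1 : 1 ≤ l := by rw [hl]; linarith [(Nat.cast_nonneg n : (0 : ℝ) ≤ n)]
  refine ⟨l ^ k * C, by positivity, (2 * n + 3) ^ n, fun s hs R => ?_⟩
  set h : ℝ := s / l with hh
  have hpos : 0 < h := by positivity
  have hinj : Function.Injective (latPt h : (Fin n → ℤ) → Euc n) := by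
    intro m m' e
    ext i
    have : (latPt h m) i = (latPt h m') i := by rw [e]
    simp only [latPt] at this
    have := mul_left_cancel₀ hpos.ne' this
    exact_mod_cast this
  obtain ⟨M, hM⟩ := exists_nat_ge (h⁻¹ * R)
  set I : Finset (Fin n → ℤ) := Fintype.piFinset fun _ => Finset.Icc (-(M : ℤ)) M with hI
  refine ⟨I.image (latPt h), fun t x => Th (h⁻¹ • (x - t)), ?_, ?_, ?_, ?_, ?_⟩
  · intro t
    exact (Th_contDiff k).comp ((contDiff_id.sub contDiff_const).const_smul _)
  · intro t x i hi
    have e1 : iteratedFDeriv ℝ i (fun x => Th (h⁻¹ • (x - t))) x =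
        iteratedFDeriv ℝ i (fun x : Euc n => Th (h⁻¹ • x)) (x - t) :=
      iteratedFDeriv_comp_sub (f := fun x : Euc n => Th (h⁻¹ • x)) i t x
    rw [e1, iteratedFDeriv_comp_const_smul _ (Th_contDiff i)]
    simp only [norm_smul, norm_pow, norm_inv, Real.norm_eq_abs, abs_of_pos hpos]
    have : s ^ i * (h⁻¹ ^ i * ‖iteratedFDeriv ℝ i Th (h⁻¹ • (x - t))‖) =
        l ^ i * ‖iteratedFDeriv ℝ i Th (h⁻¹ • (x - t))‖ := by
      rw [← mul_assoc, ← mul_pow]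
      congr 2
      rw [hh]; field_simp
    rw [this]
    gcongr
    exact hC i hi _
  · intro x hx
    rw [Finset.sum_image (fun _ _ _ _ e => hinj e)]
    have : ∀ m ∈ I, Th (h⁻¹ • (x - latPt h m)) = ∏ i, th (h⁻¹ * x i - m i) := by
      intro m _
      unfold Th
      refine Finset.prod_congr rfl fun i _ => ?_
      congr 1
      simp [latPt]
      field_simp
    rw [Finset.sum_congr rfl this, hI, ← Finset.prod_univ_sum (fun _ => Finset.Icc (-(M : ℤ)) M)
      (fun i m => th (h⁻¹ * x i - m))]
    refine Finset.prod_eq_one fun i _ => th_sum M _ ?_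
    rw [abs_mul, abs_of_pos (inv_pos.2 hpos)]
    refine le_trans ?_ hM
    have : |x i| ≤ ‖x‖ := by simpa using PiLp.norm_apply_le x i
    gcongr
    linarith
  · intro t x hx
    refine Th_zero _ ?_
    rw [norm_smul, norm_inv, Real.norm_eq_abs, abs_of_pos hpos, ← dist_eq_norm, ← hl]
    rw [hh, inv_div, div_mul_eq_mul_div, lt_div_iff₀ hs]
    gcongr
  · intro x
    have : (I.image (latPt h)).filter (fun t => dist x t ≤ s) ⊆
        (Fintype.piFinset fun i : Fin n => Finset.Icc ⌈h⁻¹ * x i - l⌉ ⌊h⁻¹ * x i + l⌋).image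
          (latPt h) := by
      intro t ht
      simp only [Finset.mem_filter, Finset.mem_image] at ht
      obtain ⟨⟨m, _, rfl⟩, hd⟩ := ht
      refine Finset.mem_image_of_mem _ ?_
      rw [Fintype.mem_piFinset]
      intro i
      have h1 : |x i - h * m i| ≤ s := by
        have := PiLp.norm_apply_le (x - latPt h m) i
        rw [← dist_eq_norm] at this
        refine le_trans ?_ hd
        simpa [latPt] using this
      have h2 : |h⁻¹ * x i - m i| ≤ l := by
        have : h⁻¹ * x i - m i = h⁻¹ * (x i - h * m i) := by field_simp
        rw [this, abs_mul, abs_of_pos (inv_pos.2 hpos)]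
        calc h⁻¹ * _ ≤ h⁻¹ * s := by gcongr
          _ = l := by rw [hh]; field_simp
      have := abs_le.1 h2
      rw [Finset.mem_Icc, Int.ceil_le, Int.le_floor]
      constructor <;> linarith
    refine (Finset.card_le_card this).trans (Finset.card_image_le.trans ?_)
    rw [Fintype.card_piFinset]
    calc ∏ i : Fin n, (Finset.Icc ⌈h⁻¹ * x i - l⌉ ⌊h⁻¹ * x i + l⌋).card
        ≤ ∏ i : Fin n, (2 * n + 3) := Finset.prod_le_prod' fun i _ => by
          rw [Int.card_Icc]
          have h1 : (⌊h⁻¹ * x i + l⌋ : ℝ) ≤ h⁻¹ * x i + l := Int.floor_le _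
          have h2 : h⁻¹ * x i - l ≤ (⌈h⁻¹ * x i - l⌉ : ℝ) := Int.le_ceil _
          have : ((⌊h⁻¹ * x i + l⌋ + 1 - ⌈h⁻¹ * x i - l⌉ : ℤ) : ℝ) ≤ ((2 * n + 3 : ℤ) : ℝ) := by
            push_cast; rw [hl] at *; linarith
          have := Int.cast_le.1 this
          omega
      _ = _ := by simp


theorem Bd.to_one {n k : ℕ} {g : Euc n → ℝ} {x : Euc n} {s M : ℝ} (hs : 0 < s) (hs1 : s ≤ 1)
    (hM : 0 ≤ M) (hg : Bd k g x s (M * s ^ k)) : Bd k g x 1 M := by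
  intro i hi
  have h := hg i hi
  have e : s ^ k = s ^ i * s ^ (k - i) := by rw [← pow_add]; congr 1; omega
  rw [e, mul_left_comm] at h
  have h2 := le_of_mul_le_mul_left h (by positivity)
  rw [one_pow, one_mul]
  refine h2.trans ?_
  have : s ^ (k - i) ≤ 1 := pow_le_one₀ hs.le hs1
  nlinarith

theorem whitney_aux (n k : ℕ) (F : Set (Euc n)) (hF : IsCompact F) (hne : F.Nonempty)
    (p : Euc n → Euc n → ℝ) (hp : ∀ x, ContDiff ℝ k (p x))
    (H : ∀ ε : ℝ, 0 < ε → ∃ δ : ℝ, 0 < δ ∧ ∀ r : ℝ, 0 < r → r < δ → ∀ x ∈ F, ∀ y ∈ F,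
      dist x y ≤ r → ∀ z, dist z x ≤ r → Bd k (fun w => p x w - p y w) z r (ε * r ^ k)) :
    ∃ w : ℕ → Euc n → ℝ, (∀ j, ContDiff ℝ k (w j)) ∧
      (∀ x ∈ F, Tendsto (fun j => w j x) atTop (nhds (p x x))) ∧
      ∀ ε : ℝ, 0 < ε → ∃ J, ∀ j ≥ J, ∀ l ≥ j, ∀ x, Bd k (fun y => w l y - w j y) x 1 ε := by
  obtain ⟨C0, hC0, N, hpu⟩ := exists_pu n k
  obtain ⟨R0, hR0⟩ := hF.isBounded.subset_ball 0
  set s : ℕ → ℝ := fun j => (4 : ℝ)⁻¹ ^ j with hs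
  have hspos : ∀ j, 0 < s j := fun j => by simp only [hs]; positivity
  have hs1 : ∀ j, s j ≤ 1 := fun j => pow_le_one₀ (by norm_num) (by norm_num)
  have hsucc : ∀ j, s j = 4 * s (j + 1) := fun j => by simp only [hs, pow_succ]; ring
  have hanti : Antitone s := antitone_nat_of_succ_le fun j => by
    have := hsucc j; have := hspos (j + 1); linarith
  have hslim : Tendsto s atTop (nhds 0) :=
    tendsto_pow_atTop_nhds_zero_of_lt_one (by norm_num) (by norm_num)
  set R : ℝ := R0 + 4 with hR
  choose T φ hφc hφb hφ1 hφ0 hφN using fun j => hpu (s j) (hspos j) R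
  set d : Euc n → ℝ := fun x => infDist x F with hd
  have hdc : Continuous d := continuous_infDist_pt F
  choose π hπF hπd using fun x => hF.exists_infDist_eq_dist hne x
  have hdle : ∀ x y, d x ≤ d y + dist x y := fun x y => infDist_le_infDist_add_dist
  have hnorm : ∀ x, d x < 4 → ‖x‖ < R := by
    intro x hx
    have h1 := mem_ball_zero_iff.1 (hR0 (hπF x))
    have h2 : dist x (π x) < 4 := by rw [← hπd x]; exact hx
    rw [dist_eq_norm] at h2
    have h3 : ‖x‖ ≤ ‖x - π x‖ + ‖π x‖ := by simpa using norm_add_le (x - π x) (π x)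
    linarith
  set u : ℕ → Euc n → ℝ := fun j x => ∑ t ∈ T j, φ j t x * p (π t) x with hu
  set χ : ℕ → Euc n → ℝ := fun j x => ∑ t ∈ (T j).filter (fun t => d t ≤ 2 * s j), φ j t x with hχ
  set w : ℕ → Euc n → ℝ := fun j x => u 0 x +
    ∑ i ∈ Finset.range j, χ i x * (u (i + 1) x - u i x) with hw
  have huc : ∀ j, ContDiff ℝ k (u j) := fun j => ContDiff.sum fun t _ => (hφc j t).mul (hp _)
  have hχc : ∀ j, ContDiff ℝ k (χ j) := fun j => ContDiff.sum fun t _ => hφc j t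
  have hwc : ∀ j, ContDiff ℝ k (w j) := fun j => (huc 0).add
    (ContDiff.sum fun i _ => (hχc i).mul ((huc (i + 1)).sub (huc i)))
  have hws : ∀ j x, w (j + 1) x = w j x + χ j x * (u (j + 1) x - u j x) := by
    intro j x; simp only [hw, Finset.sum_range_succ]; ring
  have hfar : ∀ j t x, s j < dist x t → ∀ᶠ y in nhds x, φ j t y = 0 := by
    intro j t x h
    have : ∀ᶠ y in nhds x, s j < dist y t :=
      (continuous_id.dist continuous_const).continuousAt.eventually (lt_mem_nhds h)
    filter_upwards [this] with y hy using hφ0 j t y hy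
  have hfar' : ∀ j x, ∀ᶠ y in nhds x, ∀ t ∈ T j, s j < dist x t → φ j t y = 0 := by
    intro j x
    rw [Filter.eventually_all_finset]
    intro t _
    by_cases h : s j < dist x t
    · filter_upwards [hfar j t x h] with y hy _ using hy
    · simp [h]
  have hone : ∀ j x, ‖x‖ < R → ∀ᶠ y in nhds x, ∑ t ∈ T j, φ j t y = 1 := by
    intro j x hx
    filter_upwards [continuous_norm.continuousAt.eventually (gt_mem_nhds hx)] with y hy
    exact hφ1 j y hy
  have hχ1 : ∀ j x, d x < s j → ∀ᶠ y in nhds x, χ j y = 1 := by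
    intro j x hx
    filter_upwards [hone j x (hnorm x (by linarith [hs1 j])), hfar' j x] with y h1 h2
    rw [← h1]
    refine Finset.sum_subset (Finset.filter_subset _ _) fun t ht ht' => h2 t ht ?_
    by_contra hc
    refine ht' (Finset.mem_filter.2 ⟨ht, ?_⟩)
    have := hdle t x
    rw [dist_comm] at this
    linarith
  have hχ0 : ∀ j x, 3 * s j < d x → ∀ᶠ y in nhds x, χ j y = 0 := by
    intro j x hx
    filter_upwards [hfar' j x] with y h2
    refine Finset.sum_eq_zero fun t ht => ?_
    obtain ⟨ht, ht'⟩ := Finset.mem_filter.1 ht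
    refine h2 t ht ?_
    have := hdle x t
    linarith
  have hχb : ∀ j x, Bd k (χ j) x (s j) (N * C0) := by
    intro j x
    refine (Bd.sum ((T j).filter (fun t => d t ≤ 2 * s j))
      (((T j).filter (fun t => d t ≤ 2 * s j)).filter (fun t => dist x t ≤ s j))
      (Finset.filter_subset _ _) (fun t _ => hφc j t) (hspos j).le
      (fun t _ => hφb j t x) (fun t ht ht' => ?_)).mono ?_
    · refine hfar j t x ?_
      by_contra hc
      exact ht' (Finset.mem_filter.2 ⟨ht, not_lt.1 hc⟩)
    · gcongr
      refine le_trans (Finset.card_le_card ?_) (hφN j x)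
      exact Finset.filter_subset_filter _ (Finset.filter_subset _ _)
  set C1 : ℝ := N * 2 ^ k * C0 * 26 ^ k with hC1
  have hC1pos : 0 ≤ C1 := by positivity
  have hK : ∀ ε δ : ℝ, 0 < ε → (∀ r : ℝ, 0 < r → r < δ → ∀ x ∈ F, ∀ y ∈ F,
      dist x y ≤ r → ∀ z, dist z x ≤ r → Bd k (fun w => p x w - p y w) z r (ε * r ^ k)) →
      ∀ j, 26 * s j < δ → ∀ x, ∀ x0 ∈ F, dist x x0 ≤ 12 * s j → ‖x‖ < R →
      Bd k (fun y => u j y - p x0 y) x (s j) ((C1 * ε) * s j ^ k) := by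
    intro ε δ hε hδ j hj x x0 hx0 hd0 hxR
    have hsj := hspos j
    have e : (fun y => u j y - p x0 y) =ᶠ[nhds x]
        fun y => ∑ t ∈ T j, φ j t y * (p (π t) y - p x0 y) := by
      filter_upwards [hone j x hxR] with y hy
      simp only [mul_sub, Finset.sum_sub_distrib, ← Finset.sum_mul, hy, one_mul, hu]
    refine Bd.congr ?_ e
    refine (Bd.sum (T j) ((T j).filter (fun t => dist x t ≤ s j)) (Finset.filter_subset _ _)
      (M := 2 ^ k * (C0 * (ε * (26 * s j) ^ k)))
      (fun t _ => (hφc j t).mul ((hp _).sub (hp _))) (hspos j).le (fun t ht => ?_)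
      (fun t ht ht' => ?_)).mono ?_
    · obtain ⟨_, ht⟩ := Finset.mem_filter.1 ht
      refine Bd.mul (hφc j t) ((hp _).sub (hp _)) hsj.le (hφb j t x) ?_
      have h1 : d x ≤ 12 * s j := (infDist_le_dist_of_mem hx0).trans hd0
      have h2 : dist t (π t) ≤ 13 * s j := by
        rw [← hπd t]
        have := hdle t x
        rw [dist_comm] at this
        simp only [hd] at *
        linarith
      have h3 : dist x (π t) ≤ 14 * s j := by
        linarith [dist_triangle x t (π t)]
      refine (hδ (26 * s j) (by positivity) hj (π t) (hπF t) x0 hx0 ?_ x (by linarith)).mono_r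
        hsj.le (by linarith)
      have := dist_triangle_left (π t) x0 x
      linarith
    · have : ∀ᶠ y in nhds x, φ j t y = 0 := by
        refine hfar j t x ?_
        by_contra hc
        exact ht' (Finset.mem_filter.2 ⟨ht, not_lt.1 hc⟩)
      filter_upwards [this] with y hy
      rw [hy, zero_mul]
    · have : (C1 * ε) * s j ^ k = N * (2 ^ k * (C0 * (ε * (26 * s j) ^ k))) := by
        rw [hC1, mul_pow]; ring
      rw [this]
      gcongr
      exact hφN j x
  have hB : ∀ j x, d x < 4 * s j → w j =ᶠ[nhds x] u j := by
    intro j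
    induction j with
    | zero => intro x _; simp [hw]
    | succ j ih =>
      intro x hx
      rw [← hsucc] at hx
      filter_upwards [ih x (by linarith [hspos j]), hχ1 j x hx] with y h1 h2
      rw [hws, h1, h2]; ring
  have hS : ∀ j x, 3 * s j < d x → ∀ l ≥ j, w l =ᶠ[nhds x] w j := by
    intro j x hx l hl
    induction l, hl using Nat.le_induction with
    | base => rfl
    | succ l hl ih =>
      have : s l ≤ s j := hanti hl
      filter_upwards [ih, hχ0 l x (by linarith)] with y h1 h2
      rw [hws, h1, h2]; ring
  set C2 : ℝ := C1 + 2 ^ k * ((N * C0) * (C1 + C1 * 4 ^ k)) with hC2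
  have hC2pos : 0 ≤ C2 := by positivity
  have hmain : ∀ ε δ : ℝ, 0 < ε → (∀ r : ℝ, 0 < r → r < δ → ∀ x ∈ F, ∀ y ∈ F,
      dist x y ≤ r → ∀ z, dist z x ≤ r → Bd k (fun w => p x w - p y w) z r (ε * r ^ k)) →
      ∀ j, 26 * s j < δ → ∀ x, d x ≤ 3 * s j → ∀ l ≥ j,
      Bd k (fun y => w l y - p (π x) y) x 1 (C2 * ε) := by
    intro ε δ hε hδ j hj x hx l hl
    have hxR : ‖x‖ < R := hnorm x (by linarith [hs1 j])
    have hC12 : C1 ≤ C2 := by rw [hC2]; linarith [show 0 ≤ 2 ^ k * ((N * C0) * (C1 + C1 * 4 ^ k)) by positivity]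
    by_cases hxl : d x ≤ 3 * s l
    · have h1 := hK ε δ hε hδ l (by linarith [hanti hl]) x (π x) (hπF x)
        (by rw [← hπd x]; have := hspos l; simp only [hd] at *; linarith) hxR
      have h2 := (h1.to_one (hspos l) (hs1 l) (by positivity)).mono
        (show C1 * ε ≤ C2 * ε by gcongr)
      refine h2.congr ?_
      filter_upwards [hB l x (by linarith [hspos l])] with y hy
      rw [hy]
    · push Not at hxl
      classical
      have hex : ∃ L, 3 * s L < d x := ⟨l, hxl⟩
      set L := Nat.find hex with hLdef
      have hL : 3 * s L < d x := Nat.find_spec hex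
      have hLl : L ≤ l := Nat.find_min' hex hxl
      have hLj : j < L := by
        by_contra hc
        have := hanti (not_lt.1 hc)
        linarith
      obtain ⟨L', hL'⟩ : ∃ L', L = L' + 1 := ⟨L - 1, by omega⟩
      have hdL' : d x ≤ 3 * s L' := by
        have := Nat.find_min hex (m := L') (by omega)
        exact not_lt.1 this
      rw [hL'] at hL hLl
      have hjL' : j ≤ L' := by omega
      have hs4 := hsucc L'
      have hsL := hspos (L' + 1)
      have hdx : dist x (π x) = d x := (hπd x).symm
      have a1 := hK ε δ hε hδ L' (by linarith [hanti hjL']) x (π x) (hπF x)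
        (by rw [hdx]; linarith) hxR
      have a2 := hK ε δ hε hδ (L' + 1) (by linarith [hanti hjL']) x (π x) (hπF x)
        (by rw [hdx]; linarith) hxR
      have a3 := hχb L' x
      have c1 : ContDiff ℝ k (fun y => u L' y - p (π x) y) := (huc _).sub (hp _)
      have c2 : ContDiff ℝ k (fun y => u (L' + 1) y - p (π x) y) := (huc _).sub (hp _)
      have b1 := a2.sub c2 c1 hsL.le (a1.mono_r hsL.le (by linarith))
      have b2 := Bd.mul (hχc L') (c2.sub c1) hsL.le (a3.mono_r hsL.le (by linarith)) b1
      have b3 : Bd k (fun y => χ L' y * (u (L' + 1) y - p (π x) y - (u L' y - p (π x) y))) x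
          (s (L' + 1)) ((2 ^ k * ((N * C0) * (C1 + C1 * 4 ^ k)) * ε) * s (L' + 1) ^ k) := by
        refine b2.mono (le_of_eq ?_)
        rw [hs4, mul_pow]; ring
      have b4 := b3.to_one hsL (hs1 _) (by positivity)
      have b5 := a1.to_one (hspos L') (hs1 _) (by positivity)
      have b6 := b5.add c1 ((hχc L').mul (c2.sub c1)) zero_le_one b4
      refine (b6.congr ?_).mono (le_of_eq ?_)
      · filter_upwards [hS (L' + 1) x hL l hLl, hB L' x (by linarith [hspos L'])] with y h1 h2
        rw [h1, hws, h2]; ring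
      · rw [hC2]; ring
  refine ⟨w, hwc, ?_, ?_⟩
  · intro x hx
    have hdx : d x = 0 := infDist_zero_of_mem hx
    have hπx : π x = x := by
      have := hπd x
      rw [show infDist x F = d x from rfl, hdx] at this
      exact (dist_eq_zero.1 this.symm).symm
    rw [Metric.tendsto_atTop]
    intro ε hε
    obtain ⟨δ, hδ, hδ'⟩ := H (ε / (C2 + 1)) (by positivity)
    obtain ⟨J, hJ⟩ := (hslim.eventually (gt_mem_nhds (show (0 : ℝ) < δ / 26 by positivity))).exists
    refine ⟨J, fun l hl => ?_⟩
    have := hmain _ δ (by positivity) hδ' J (by linarith) x (by rw [hdx]; linarith [hspos J]) l hl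
      0 (Nat.zero_le _)
    rw [hπx] at this
    simp only [pow_zero, one_mul, norm_iteratedFDeriv_zero] at this
    rw [Real.dist_eq, ← Real.norm_eq_abs]
    refine this.trans_lt ?_
    rw [mul_div_assoc', div_lt_iff₀ (by positivity)]
    nlinarith
  · intro ε hε
    obtain ⟨δ, hδ, hδ'⟩ := H (ε / (2 * (C2 + 1))) (by positivity)
    obtain ⟨J, hJ⟩ := (hslim.eventually (gt_mem_nhds (show (0 : ℝ) < δ / 26 by positivity))).exists
    refine ⟨J, fun j hj l hl x => ?_⟩
    have hsj := hanti hj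
    by_cases hx : d x ≤ 3 * s j
    · have h1 := hmain _ δ (by positivity) hδ' j (by linarith) x hx l hl
      have h2 := hmain _ δ (by positivity) hδ' j (by linarith) x hx j le_rfl
      have h3 := h1.sub ((hwc l).sub (hp _)) ((hwc j).sub (hp _)) zero_le_one h2
      refine (h3.mono ?_).congr (Eventually.of_forall fun y => ?_)
      · have : C2 * (ε / (2 * (C2 + 1))) + C2 * (ε / (2 * (C2 + 1))) = ε * (C2 / (C2 + 1)) := by
          field_simp; ring
        rw [this]
        have : C2 / (C2 + 1) ≤ 1 := by rw [div_le_one (by positivity)]; linarith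
        nlinarith
      · simp only []; ring
    · refine (Bd.zero hε.le).congr ?_
      filter_upwards [hS j x (not_le.1 hx) l hl] with y hy
      rw [hy, sub_self]

theorem whitney (n k : ℕ) (F : Set (Euc n)) (hF : IsCompact F)
    (p : Euc n → Euc n → ℝ) (hp : ∀ x, ContDiff ℝ k (p x))
    (H : ∀ ε : ℝ, 0 < ε → ∃ δ : ℝ, 0 < δ ∧ ∀ r : ℝ, 0 < r → r < δ → ∀ x ∈ F, ∀ y ∈ F,
      dist x y ≤ r → ∀ z, dist z x ≤ r → Bd k (fun w => p x w - p y w) z r (ε * r ^ k)) :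
    ∃ u : Euc n → ℝ, ContDiff ℝ k u ∧ ∀ x ∈ F, u x = p x x := by
  rcases F.eq_empty_or_nonempty with rfl | hne
  · exact ⟨fun _ => 0, contDiff_const, by simp⟩
  obtain ⟨w, hwc, hlim, hcau⟩ := whitney_aux n k F hF hne p hp H
  choose J hJ using fun m : ℕ => hcau ((1 / 2 : ℝ) ^ m) (by positivity)
  set q : ℕ → ℕ := fun m => ∑ i ∈ Finset.range (m + 1), (J i + 1) with hq
  have hqJ : ∀ m, J m ≤ q m := fun m => by
    have : J m + 1 ≤ q m := Finset.single_le_sum (f := fun i => J i + 1) (fun _ _ => Nat.zero_le _)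
      (Finset.self_mem_range_succ m)
    omega
  have hqs : StrictMono q := strictMono_nat_of_lt_succ fun m => by
    simp only [hq]; rw [Finset.sum_range_succ _ (m + 1)]; omega
  set g : ℕ → Euc n → ℝ := fun m y => w (q (m + 1)) y - w (q m) y with hg
  have hgb : ∀ m x, Bd k (g m) x 1 ((1 / 2 : ℝ) ^ m) := fun m x =>
    hJ m (q m) (hqJ m) (q (m + 1)) (hqs (Nat.lt_succ_self m)).le x
  have hgb' : ∀ (i m : ℕ) (x : Euc n), i ≤ k → ‖iteratedFDeriv ℝ i (g m) x‖ ≤ (1 / 2 : ℝ) ^ m := by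
    intro i m x hi
    simpa using hgb m x i hi
  have hcd : ContDiff ℝ k (fun x => ∑' m, g m x) := by
    refine contDiff_tsum (N := (k : ℕ∞)) (v := fun _ m => (1 / 2 : ℝ) ^ m)
      (fun m => (hwc _).sub (hwc _)) (fun _ _ => summable_geometric_two) ?_
    intro i m x hi
    exact hgb' i m x (by exact_mod_cast hi)
  refine ⟨fun x => w (q 0) x + ∑' m, g m x, (hwc _).add hcd, fun x hx => ?_⟩
  have hsum : Summable (fun m => g m x) := by
    refine Summable.of_norm_bounded summable_geometric_two (fun m => ?_)
    simpa using hgb' 0 m x (Nat.zero_le _)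
  have h1 := hsum.hasSum.tendsto_sum_nat
  have h2 : ∀ m, ∑ i ∈ Finset.range m, g i x = w (q m) x - w (q 0) x := fun m =>
    Finset.sum_range_sub (fun i => w (q i) x) m
  simp only [h2] at h1
  have h3 := ((hlim x hx).comp hqs.tendsto_atTop).sub_const (w (q 0) x)
  have := tendsto_nhds_unique h1 h3
  simp only []
  rw [this]; ring


/-- Polynomial with given coefficients. -/
def Pa {n k : ℕ} (a : multiIdxLe n k → ℝ) (x : Euc n) : ℝ :=
  ∑ J : multiIdxLe n k, a J * mpow x (J : Fin n → ℕ)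

theorem mem_multiIdxLe {n k : ℕ} (J : Fin n → ℕ) : J ∈ multiIdxLe n k ↔ mdeg J ≤ k := by
  unfold multiIdxLe
  rw [Finset.mem_filter]
  refine ⟨fun h => h.2, fun h => ⟨?_, h⟩⟩
  rw [Fintype.mem_piFinset]
  intro i
  rw [Finset.mem_range]
  have : J i ≤ mdeg J := Finset.single_le_sum (f := J) (fun _ _ => Nat.zero_le _) (Finset.mem_univ i)
  omega

theorem IsPolyFun.exists_Pa {n k : ℕ} {p : Euc n → ℝ} (h : IsPolyFun n k p) :
    ∃ a : multiIdxLe n k → ℝ, p = Pa a := by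
  obtain ⟨P, hP, hp⟩ := h
  refine ⟨fun J => P.coeff (Finsupp.equivFunOnFinite.symm (J : Fin n → ℕ)), ?_⟩
  ext x
  rw [hp x, MvPolynomial.eval_eq']
  unfold Pa mpow
  rw [Finset.sum_coe_sort (multiIdxLe n k)
    (fun J => P.coeff (Finsupp.equivFunOnFinite.symm J) * ∏ i, x i ^ J i)]
  have : ∑ d ∈ P.support, P.coeff d * ∏ i, x i ^ d i =
      ∑ J ∈ P.support.map Finsupp.equivFunOnFinite.toEmbedding,
        P.coeff (Finsupp.equivFunOnFinite.symm J) * ∏ i, x i ^ J i := by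
    rw [Finset.sum_map]
    refine Finset.sum_congr rfl fun d _ => ?_
    simp
  rw [this]
  refine Finset.sum_subset ?_ ?_
  · intro J hJ
    obtain ⟨d, hd, rfl⟩ := Finset.mem_map.1 hJ
    rw [mem_multiIdxLe]
    have := (MvPolynomial.le_totalDegree hd).trans hP
    rw [Finsupp.sum_fintype _ _ (by simp)] at this
    exact this
  · intro J _ hJ
    have : Finsupp.equivFunOnFinite.symm J ∉ P.support := by
      intro hc
      exact hJ (Finset.mem_map.2 ⟨_, hc, by simp⟩)
    rw [MvPolynomial.notMem_support_iff.1 this, zero_mul]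

theorem IsPolyFun.sub {n k : ℕ} {p q : Euc n → ℝ} (hp : IsPolyFun n k p) (hq : IsPolyFun n k q) :
    IsPolyFun n k (fun x => p x - q x) := by
  obtain ⟨P, hP, hp⟩ := hp
  obtain ⟨Q, hQ, hq⟩ := hq
  refine ⟨P - Q, (MvPolynomial.totalDegree_sub _ _).trans (max_le hP hQ), fun x => ?_⟩
  show p x - q x = _
  rw [hp, hq, map_sub]

theorem IsPolyFun.add {n k : ℕ} {p q : Euc n → ℝ} (hp : IsPolyFun n k p) (hq : IsPolyFun n k q) :
    IsPolyFun n k (fun x => p x + q x) := by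
  obtain ⟨P, hP, hp⟩ := hp
  obtain ⟨Q, hQ, hq⟩ := hq
  refine ⟨P + Q, (MvPolynomial.totalDegree_add _ _).trans (max_le hP hQ), fun x => ?_⟩
  show p x + q x = _
  rw [hp, hq, map_add]

theorem IsPolyFun.mul {n k l : ℕ} {p q : Euc n → ℝ} (hp : IsPolyFun n k p) (hq : IsPolyFun n l q) :
    IsPolyFun n (k + l) (fun x => p x * q x) := by
  obtain ⟨P, hP, hp⟩ := hp
  obtain ⟨Q, hQ, hq⟩ := hq
  refine ⟨P * Q, (MvPolynomial.totalDegree_mul _ _).trans (by omega), fun x => ?_⟩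
  show p x * q x = _
  rw [hp, hq, map_mul]

theorem IsPolyFun.mono {n k l : ℕ} {p : Euc n → ℝ} (hp : IsPolyFun n k p) (h : k ≤ l) :
    IsPolyFun n l p := by
  obtain ⟨P, hP, hp⟩ := hp
  exact ⟨P, hP.trans h, hp⟩

theorem IsPolyFun.const {n : ℕ} (k : ℕ) (c : ℝ) : IsPolyFun n k (fun _ => c) :=
  ⟨MvPolynomial.C c, by simp, by simp⟩

theorem IsPolyFun.coord {n : ℕ} (i : Fin n) : IsPolyFun n 1 (fun x => x i) :=
  ⟨MvPolynomial.X i, by simp, by simp⟩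

theorem IsPolyFun.sum {n k : ℕ} {ι : Type*} (s : Finset ι) {p : ι → Euc n → ℝ}
    (hp : ∀ i ∈ s, IsPolyFun n k (p i)) : IsPolyFun n k (fun x => ∑ i ∈ s, p i x) := by
  classical
  induction s using Finset.induction_on with
  | empty => simpa using IsPolyFun.const k 0
  | insert a s ha ih =>
    simp only [Finset.sum_insert ha]
    exact (hp a (Finset.mem_insert_self _ _)).add
      (ih fun i hi => hp i (Finset.mem_insert_of_mem hi))

theorem IsPolyFun.prod {n : ℕ} {ι : Type*} (s : Finset ι) {p : ι → Euc n → ℝ} {k : ι → ℕ}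
    (hp : ∀ i ∈ s, IsPolyFun n (k i) (p i)) :
    IsPolyFun n (∑ i ∈ s, k i) (fun x => ∏ i ∈ s, p i x) := by
  classical
  induction s using Finset.induction_on with
  | empty => simpa using IsPolyFun.const 0 1
  | insert a s ha ih =>
    simp only [Finset.sum_insert ha, Finset.prod_insert ha]
    exact (hp a (Finset.mem_insert_self _ _)).mul
      (ih fun i hi => hp i (Finset.mem_insert_of_mem hi))

theorem IsPolyFun.pow {n k : ℕ} {p : Euc n → ℝ} (hp : IsPolyFun n k p) (m : ℕ) :
    IsPolyFun n (m * k) (fun x => p x ^ m) := by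
  have := IsPolyFun.prod (Finset.range m) (p := fun _ => p) (k := fun _ => k) (fun _ _ => hp)
  simpa using this

theorem IsPolyFun.affine {n k : ℕ} {p : Euc n → ℝ} (hp : IsPolyFun n k p) (x0 : Euc n) (r : ℝ) :
    IsPolyFun n k (fun y => p (x0 + r • y)) := by
  obtain ⟨a, rfl⟩ := hp.exists_Pa
  unfold Pa mpow
  refine IsPolyFun.sum _ fun J _ => ?_
  have h1 : IsPolyFun n (∑ i, (J : Fin n → ℕ) i * 1)
      (fun y => ∏ i, ((x0 + r • y) i) ^ (J : Fin n → ℕ) i) := by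
    refine IsPolyFun.prod _ fun i _ => IsPolyFun.pow ?_ _
    have := (IsPolyFun.const 1 (x0 i)).add ((IsPolyFun.const 0 r).mul (IsPolyFun.coord i))
    simpa using this
  have h2 : mdeg (J : Fin n → ℕ) ≤ k := (mem_multiIdxLe _).1 J.2
  have h3 := (IsPolyFun.const 0 (a J)).mul h1
  exact h3.mono (by simpa [mdeg] using h2)

theorem IsPolyFun_Pa {n k : ℕ} (a : multiIdxLe n k → ℝ) : IsPolyFun n k (Pa a) := by
  unfold Pa mpow
  refine IsPolyFun.sum _ fun J _ => ?_
  have h1 : IsPolyFun n (∑ i, (J : Fin n → ℕ) i * 1)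
      (fun y => ∏ i, (y i) ^ (J : Fin n → ℕ) i) :=
    IsPolyFun.prod _ fun i _ => IsPolyFun.pow (IsPolyFun.coord i) _
  have h2 : mdeg (J : Fin n → ℕ) ≤ k := (mem_multiIdxLe _).1 J.2
  have h3 := (IsPolyFun.const 0 (a J)).mul h1
  exact h3.mono (by simpa [mdeg] using h2)

theorem mpow_contDiff {n : ℕ} (k : ℕ) (J : Fin n → ℕ) :
    ContDiff ℝ k (fun x : Euc n => mpow x J) := by
  unfold mpow
  refine contDiff_prod fun i _ => ContDiff.pow ?_ _
  fun_prop

theorem Pa_contDiff {n k : ℕ} (a : multiIdxLe n k → ℝ) (l : ℕ) : ContDiff ℝ l (Pa a) := by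
  unfold Pa
  exact ContDiff.sum fun J _ => contDiff_const.mul (mpow_contDiff l _)

theorem Pa_continuous {n k : ℕ} :
    Continuous (fun z : (multiIdxLe n k → ℝ) × Euc n => Pa z.1 z.2) := by
  unfold Pa mpow
  fun_prop

theorem Pa_smul {n k : ℕ} (c : ℝ) (a : multiIdxLe n k → ℝ) (x : Euc n) :
    Pa (c • a) x = c * Pa a x := by
  unfold Pa
  rw [Finset.mul_sum]
  exact Finset.sum_congr rfl fun J _ => by simp [mul_assoc]

theorem Pa_sub {n k : ℕ} (a b : multiIdxLe n k → ℝ) (x : Euc n) :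
    Pa (a - b) x = Pa a x - Pa b x := by
  unfold Pa
  rw [← Finset.sum_sub_distrib]
  exact Finset.sum_congr rfl fun J _ => by simp [sub_mul]

theorem Pa_inj {n k : ℕ} (a : multiIdxLe n k → ℝ) (h : ∀ x ∈ ball (0 : Euc n) 1, Pa a x = 0) :
    a = 0 := by
  set P : MvPolynomial (Fin n) ℝ := ∑ J : multiIdxLe n k,
    MvPolynomial.monomial (Finsupp.equivFunOnFinite.symm (J : Fin n → ℕ)) (a J) with hP
  have hev : ∀ x : Euc n, MvPolynomial.eval (fun i => x i) P = Pa a x := by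
    intro x
    rw [hP, map_sum]
    unfold Pa mpow
    refine Finset.sum_congr rfl fun J _ => ?_
    rw [MvPolynomial.eval_monomial, Finsupp.prod_fintype _ _ (by simp)]
    simp
  have hP0 : P = 0 := by
    refine MvPolynomial.funext_set (fun _ => Set.Ioo 0 (1 / ((n : ℝ) + 1)))
      (fun _ => Set.Ioo_infinite (by positivity)) fun x hx => ?_
    rw [map_zero]
    have := hev (WithLp.toLp 2 x)
    simp only [] at this
    rw [this]
    apply h
    rw [mem_ball_zero_iff]
    have hy : ∀ i, |(((n : ℝ) + 1) • (WithLp.toLp 2 x : Euc n)) i| < 1 := by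
      intro i
      have h1 := hx i (Set.mem_univ i)
      simp only [Set.mem_Ioo] at h1
      simp only [PiLp.smul_apply, smul_eq_mul]
      rw [abs_of_pos (by have := h1.1; positivity)]
      have := h1.2
      rw [lt_div_iff₀ (by positivity)] at this
      linarith
    have hsq : ‖(WithLp.toLp 2 x : Euc n)‖ ^ 2 < 1 := by
      rw [EuclideanSpace.norm_sq_eq]
      calc ∑ i, ‖(WithLp.toLp 2 x : Euc n) i‖ ^ 2 ≤ ∑ i : Fin n, (1 / ((n : ℝ) + 1)) ^ 2 := by
            refine Finset.sum_le_sum fun i _ => ?_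
            have h1 := hx i (Set.mem_univ i)
            simp only [Set.mem_Ioo] at h1
            rw [Real.norm_eq_abs, abs_of_pos h1.1]
            gcongr
            · exact h1.1.le
            · exact h1.2.le
        _ = n * (1 / ((n : ℝ) + 1)) ^ 2 := by simp
        _ < 1 := by
            have := (Nat.cast_nonneg n : (0 : ℝ) ≤ n)
            rw [div_pow, one_pow, mul_one_div, div_lt_one (by positivity)]
            nlinarith
    nlinarith [norm_nonneg (WithLp.toLp 2 x : Euc n)]
  funext J
  have := congrArg (MvPolynomial.coeff (Finsupp.equivFunOnFinite.symm (J : Fin n → ℕ))) hP0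
  rw [hP, MvPolynomial.coeff_sum] at this
  simp only [MvPolynomial.coeff_monomial, MvPolynomial.coeff_zero, EmbeddingLike.apply_eq_iff_eq]
    at this
  rw [Finset.sum_eq_single J] at this
  · simpa using this
  · intro b _ hb
    rw [if_neg]
    intro hc
    exact hb (Subtype.ext hc)
  · simp

theorem DG_unit (n k : ℕ) : ∃ c : ℝ, 0 < c ∧ ∃ η : ENNReal, 0 < η ∧
    ∀ (a : multiIdxLe n k → ℝ) (M : ℝ), 0 ≤ M →
      volume {y | y ∈ ball (0 : Euc n) 1 ∧ M < |Pa a y|} < η → c * ‖a‖ ≤ M := by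
  have key : ∃ c : ℝ, 0 < c ∧ ∃ η : ENNReal, 0 < η ∧
    ∀ a ∈ sphere (0 : multiIdxLe n k → ℝ) 1, ∀ (M : ℝ),
      volume {y | y ∈ ball (0 : Euc n) 1 ∧ M < |Pa a y|} < η → c ≤ M := by
    refine (isCompact_sphere (0 : multiIdxLe n k → ℝ) 1).induction_on
      (p := fun S => ∃ c : ℝ, 0 < c ∧ ∃ η : ENNReal, 0 < η ∧
        ∀ a ∈ S, ∀ (M : ℝ),
        volume {y | y ∈ ball (0 : Euc n) 1 ∧ M < |Pa a y|} < η → c ≤ M) ?_ ?_ ?_ ?_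
    · exact ⟨1, one_pos, 1, one_pos, by simp⟩
    · rintro S S' hS ⟨c, hc, η, hη, h⟩
      exact ⟨c, hc, η, hη, fun a ha => h a (hS ha)⟩
    · rintro S S' ⟨c, hc, η, hη, h⟩ ⟨c', hc', η', hη', h'⟩
      refine ⟨min c c', lt_min hc hc', min η η', lt_min hη hη', ?_⟩
      rintro a (ha | ha) M hM
      · exact (min_le_left _ _).trans (h a ha M (hM.trans_le (min_le_left _ _)))
      · exact (min_le_right _ _).trans (h' a ha M (hM.trans_le (min_le_right _ _)))
    · intro a ha
      have ha0 : a ≠ 0 := by rintro rfl; simp at ha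
      obtain ⟨z, hz, hz0⟩ : ∃ z ∈ ball (0 : Euc n) 1, Pa a z ≠ 0 := by
        by_contra hc
        push Not at hc
        exact ha0 (Pa_inj a hc)
      have hpos : 0 < |Pa a z| := abs_pos.2 hz0
      have hcont : ∀ᶠ w : (multiIdxLe n k → ℝ) × Euc n in nhds (a, z),
          |Pa a z| / 2 < |Pa w.1 w.2| :=
        (Pa_continuous.abs.continuousAt (x := (a, z))).eventually (lt_mem_nhds (by linarith))
      rw [nhds_prod_eq] at hcont
      obtain ⟨pa, hpa, pb, hpb, hab⟩ := Filter.eventually_prod_iff.1 hcont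
      obtain ⟨V, hV, hVo, hzV⟩ := _root_.mem_nhds_iff.1 (hpb.and (isOpen_ball.mem_nhds hz))
      refine ⟨{a | pa a}, mem_nhdsWithin_of_mem_nhds hpa, |Pa a z| / 2, by linarith,
        volume V, hVo.measure_pos _ ⟨z, hzV⟩, ?_⟩
      intro a' ha' M hM
      by_contra hc
      refine absurd hM (not_lt.2 (measure_mono fun y hy => ?_))
      have hy' := hV hy
      refine ⟨hy'.2, ?_⟩
      have := hab ha' hy'.1
      simp only [] at this
      linarith
  obtain ⟨c, hc, η, hη, h⟩ := key
  refine ⟨c, hc, η, hη, fun a M hM0 hM => ?_⟩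
  by_cases ha : a = 0
  · subst ha; simpa using hM0
  have hna : 0 < ‖a‖ := norm_pos_iff.2 ha
  have := h (‖a‖⁻¹ • a) (by simp [norm_smul, hna.ne']) (‖a‖⁻¹ * M) ?_
  · rw [← div_eq_inv_mul, le_div_iff₀ hna] at this; exact this
  · refine lt_of_le_of_lt (measure_mono ?_) hM
    rintro y ⟨hy, hy'⟩
    refine ⟨hy, ?_⟩
    rw [Pa_smul, abs_mul, abs_of_pos (inv_pos.2 hna)] at hy'
    exact lt_of_mul_lt_mul_left hy' (inv_pos.2 hna).le

theorem Bd.const_mul {n k : ℕ} {g : Euc n → ℝ} {x : Euc n} {r M : ℝ} (c : ℝ)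
    (hg' : ContDiff ℝ k g) (hg : Bd k g x r M) : Bd k (fun y => c * g y) x r (|c| * M) := by
  intro i hi
  have hi' : (i : WithTop ℕ∞) ≤ k := by exact_mod_cast hi
  have e : iteratedFDeriv ℝ i (fun y => c * g y) x = c • iteratedFDeriv ℝ i g x :=
    iteratedFDeriv_const_smul_apply' (a := c) (f := g) (hg'.of_le hi').contDiffAt
  rw [e, norm_smul, Real.norm_eq_abs, mul_left_comm]
  exact mul_le_mul_of_nonneg_left (hg i hi) (abs_nonneg c)

theorem Pa_Bd (n k : ℕ) : ∃ C : ℝ, 0 < C ∧ ∀ (a : multiIdxLe n k → ℝ) (y : Euc n), ‖y‖ ≤ 1 →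
    Bd k (Pa a) y 1 (C * ‖a‖) := by
  have h1 : ∀ J : multiIdxLe n k, ∃ C : ℝ, 0 ≤ C ∧ ∀ y : Euc n, ‖y‖ ≤ 1 →
      Bd k (fun x : Euc n => mpow x (J : Fin n → ℕ)) y 1 C := by
    intro J
    have : ∀ i : ℕ, i ≤ k → ∃ C : ℝ, ∀ y ∈ closedBall (0 : Euc n) 1,
        ‖iteratedFDeriv ℝ i (fun x : Euc n => mpow x (J : Fin n → ℕ)) y‖ ≤ C := by
      intro i hi
      refine (isCompact_closedBall _ _).exists_bound_of_continuousOn ?_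
      exact ((mpow_contDiff k _).continuous_iteratedFDeriv (by exact_mod_cast hi)).continuousOn
    choose! C hC using this
    refine ⟨∑ i ∈ Finset.range (k + 1), |C i|, by positivity, fun y hy i hi => ?_⟩
    have h2 : |C i| ≤ ∑ i ∈ Finset.range (k + 1), |C i| :=
      Finset.single_le_sum (f := fun i => |C i|) (fun _ _ => abs_nonneg _)
        (Finset.mem_range.2 (by omega))
    have h3 := hC i hi y (by simpa using hy)
    rw [one_pow, one_mul]
    linarith [le_abs_self (C i)]
  choose C hC0 hC using h1
  refine ⟨Finset.card (Finset.univ : Finset (multiIdxLe n k)) * ∑ J, C J + 1, by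
    have := Finset.sum_nonneg (s := Finset.univ) (fun J _ => hC0 J); positivity, fun a y hy => ?_⟩
  have := Bd.sum Finset.univ Finset.univ (Finset.Subset.refl _) (k := k) (x := y) (r := 1)
    (M := ‖a‖ * ∑ J, C J)
    (g := fun (J : multiIdxLe n k) x => a J * mpow x (J : Fin n → ℕ))
    (fun J _ => contDiff_const.mul (mpow_contDiff k _)) zero_le_one (fun J _ => ?_) (by simp)
  · refine this.mono ?_
    have := norm_nonneg a
    nlinarith
  · refine ((hC J y hy).const_mul (a J) (mpow_contDiff k _)).mono ?_
    gcongr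
    · exact hC0 J
    · simpa using norm_le_pi_norm a J
    · exact Finset.single_le_sum (fun J _ => hC0 J) (Finset.mem_univ J)

theorem Pa_growth (n k : ℕ) : ∃ C : ℝ, 0 < C ∧ ∀ (a : multiIdxLe n k → ℝ) (y : Euc n),
    |Pa a y| ≤ C * ‖a‖ * (1 + ‖y‖) ^ k := by
  refine ⟨Finset.card (Finset.univ : Finset (multiIdxLe n k)) + 1, by positivity, fun a y => ?_⟩
  have h1 : ∀ J : multiIdxLe n k, |a J * mpow y (J : Fin n → ℕ)| ≤ ‖a‖ * (1 + ‖y‖) ^ k := by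
    intro J
    rw [abs_mul]
    gcongr
    · simpa using norm_le_pi_norm a J
    · unfold mpow
      rw [Finset.abs_prod]
      calc ∏ i, |y i ^ (J : Fin n → ℕ) i| ≤ ∏ i, (1 + ‖y‖) ^ (J : Fin n → ℕ) i := by
            refine Finset.prod_le_prod (fun _ _ => abs_nonneg _) fun i _ => ?_
            rw [abs_pow]
            gcongr
            have : |y i| ≤ ‖y‖ := by simpa using PiLp.norm_apply_le y i
            linarith
        _ = (1 + ‖y‖) ^ mdeg (J : Fin n → ℕ) := by rw [Finset.prod_pow_eq_pow_sum]; rfl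
        _ ≤ _ := pow_le_pow_right₀ (by linarith [norm_nonneg y]) ((mem_multiIdxLe _).1 J.2)
  calc |Pa a y| ≤ ∑ J : multiIdxLe n k, |a J * mpow y (J : Fin n → ℕ)| := Finset.abs_sum_le_sum_abs _ _
    _ ≤ ∑ J : multiIdxLe n k, ‖a‖ * (1 + ‖y‖) ^ k := Finset.sum_le_sum fun J _ => h1 J
    _ = Finset.card (Finset.univ : Finset (multiIdxLe n k)) * (‖a‖ * (1 + ‖y‖) ^ k) := by simp
    _ ≤ _ := by
      have : 0 ≤ ‖a‖ * (1 + ‖y‖) ^ k := by positivity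
      nlinarith

/-- De Giorgi type lemma. -/
theorem DG (n k : ℕ) : ∃ η : ENNReal, 0 < η ∧ ∃ C : ℝ, 0 < C ∧
    ∀ q : Euc n → ℝ, IsPolyFun n k q → ∀ (x0 : Euc n) (r M : ℝ), 0 < r → 0 ≤ M →
      volume {y | y ∈ ball x0 r ∧ M < |q y|} < η * ENNReal.ofReal (r ^ n) →
      (∀ z, dist z x0 ≤ r → Bd k q z r (C * M)) ∧
      ∀ z, |q z| ≤ C * M * (1 + dist z x0 / r) ^ k := by
  obtain ⟨c, hc, η, hη, h⟩ := DG_unit n k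
  obtain ⟨C1, hC1, hb⟩ := Pa_Bd n k
  obtain ⟨C2, hC2, hgr⟩ := Pa_growth n k
  refine ⟨η, hη, (C1 + C2) * c⁻¹, by positivity, fun q hq x0 r M hr hM hvol => ?_⟩
  obtain ⟨b, hbq⟩ := (hq.affine x0 r).exists_Pa
  have hbq' : ∀ y, q (x0 + r • y) = Pa b y := fun y => congrFun hbq y
  have hqz : ∀ z, q z = Pa b (r⁻¹ • (z - x0)) := by
    intro z
    rw [← hbq', smul_smul, mul_inv_cancel₀ hr.ne', one_smul]; simp
  have hnorm : ∀ z, ‖r⁻¹ • (z - x0)‖ = dist z x0 / r := by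
    intro z
    rw [norm_smul, norm_inv, Real.norm_eq_abs, abs_of_pos hr, ← dist_eq_norm]; ring
  have hbM : ‖b‖ ≤ c⁻¹ * M := by
    have : c * ‖b‖ ≤ M := by
      refine h b M hM ?_
      have e : {y | y ∈ ball (0 : Euc n) 1 ∧ M < |Pa b y|} =
          (fun y => r • y) ⁻¹' ((fun y => x0 + y) ⁻¹' {y | y ∈ ball x0 r ∧ M < |q y|}) := by
        ext y
        simp only [Set.mem_ofPred_eq, Set.mem_preimage, dist_zero_right, hbq', mem_ball,
          dist_self_add_left, norm_smul, Real.norm_eq_abs, abs_of_pos hr]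
        rw [mul_lt_iff_lt_one_right hr]
      rw [e, Measure.addHaar_preimage_smul _ hr.ne', measure_preimage_add]
      rw [finrank_euclideanSpace_fin, abs_of_pos (by positivity), ENNReal.ofReal_inv_of_pos
        (by positivity), mul_comm, ← div_eq_mul_inv]
      refine ENNReal.div_lt_of_lt_mul hvol
    rw [← div_eq_inv_mul, le_div_iff₀ hc]; linarith
  refine ⟨fun z hz i hi => ?_, fun z => ?_⟩
  · have e0 : q = fun z => Pa b (r⁻¹ • (z - x0)) := funext hqz
    have e1 : iteratedFDeriv ℝ i q z =
        iteratedFDeriv ℝ i (fun x : Euc n => Pa b (r⁻¹ • x)) (z - x0) := by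
      rw [e0]
      exact iteratedFDeriv_comp_sub (f := fun x : Euc n => Pa b (r⁻¹ • x)) i x0 z
    rw [e1, iteratedFDeriv_comp_const_smul _ (Pa_contDiff b i)]
    simp only [norm_smul, norm_pow, norm_inv, Real.norm_eq_abs, abs_of_pos hr]
    rw [← mul_assoc, ← mul_pow, mul_inv_cancel₀ hr.ne']
    refine (hb b (r⁻¹ • (z - x0)) ?_ i hi).trans ?_
    · rw [hnorm, div_le_one hr]; exact hz
    · have : (0 : ℝ) ≤ c⁻¹ * M := by positivity
      nlinarith [norm_nonneg b]
  · rw [hqz]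
    refine (hgr b _).trans ?_
    rw [hnorm]
    have h0 : 0 ≤ dist z x0 / r := by positivity
    have : (0 : ℝ) ≤ c⁻¹ * M := by positivity
    have h3 : C2 * ‖b‖ ≤ (C1 + C2) * c⁻¹ * M := by nlinarith [norm_nonneg b]
    exact mul_le_mul_of_nonneg_right h3 (by positivity)


theorem IsPolyFun_multilinear {n i : ℕ} (L : ContinuousMultilinearMap ℝ (fun _ : Fin i => Euc n) ℝ) :
    IsPolyFun n i (fun y => L (fun _ => y)) := by
  have e : (fun y : Euc n => L (fun _ => y)) = fun y => ∑ c : Fin i → Fin n,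
      L (fun l => EuclideanSpace.single (c l) (1 : ℝ)) * ∏ l, y (c l) := by
    funext y
    have hy : y = ∑ j, y j • EuclideanSpace.single j (1 : ℝ) := by
      ext j
      simp [Finset.sum_apply, Pi.single_apply]
    conv_lhs => rw [hy]
    rw [L.map_sum (g := fun _ j => y j • EuclideanSpace.single j (1 : ℝ))]
    refine Finset.sum_congr rfl fun c _ => ?_
    rw [L.map_smul_univ (fun l => y (c l))]
    simp [mul_comm]
  rw [e]
  refine IsPolyFun.sum _ fun c _ => ?_
  have h1 : IsPolyFun n (∑ l : Fin i, 1) (fun y => ∏ l, y (c l)) :=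
    IsPolyFun.prod _ fun l _ => IsPolyFun.coord (c l)
  have := (IsPolyFun.const 0 (L (fun l => EuclideanSpace.single (c l) (1 : ℝ)))).mul h1
  exact this.mono (by simp)

theorem IsPolyFun.translate {n k : ℕ} {p : Euc n → ℝ} (hp : IsPolyFun n k p) (x0 : Euc n) :
    IsPolyFun n k (fun y => p (y - x0)) := by
  have := hp.affine (-x0) 1
  simpa [sub_eq_neg_add] using this

theorem taylor_littleO {n k : ℕ} {u : Euc n → ℝ} (hu : ContDiff ℝ k u) (x0 : Euc n) :
    ∃ p : Euc n → ℝ, IsPolyFun n k p ∧ ∀ ε : ℝ, 0 < ε → ∃ δ : ℝ, 0 < δ ∧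
      ∀ y, dist y x0 < δ → |u y - p y| ≤ ε * ‖y - x0‖ ^ k := by
  cases k with
  | zero =>
    refine ⟨fun _ => u x0, IsPolyFun.const _ _, fun ε hε => ?_⟩
    obtain ⟨δ, hδ, h⟩ := Metric.continuousAt_iff.1 (hu.continuous.continuousAt (x := x0)) ε hε
    refine ⟨δ, hδ, fun y hy => ?_⟩
    have := h hy
    rw [Real.dist_eq] at this
    simpa using this.le
  | succ m =>
    set c : ℝ := (m.factorial : ℝ)⁻¹ * ∫ t in (0 : ℝ)..1, (1 - t) ^ m with hc
    set q : Euc n → ℝ := fun y => (∑ i ∈ Finset.range (m + 1),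
      (i.factorial : ℝ)⁻¹ * (iteratedFDeriv ℝ i u x0 (fun _ => y))) +
        c * iteratedFDeriv ℝ (m + 1) u x0 (fun _ => y) with hq
    have hqp : IsPolyFun n (m + 1) q := by
      refine IsPolyFun.add (IsPolyFun.sum _ fun i hi => ?_) ?_
      · refine ((IsPolyFun.const 0 _).mul (IsPolyFun_multilinear _)).mono ?_
        have := Finset.mem_range.1 hi
        omega
      · exact ((IsPolyFun.const 0 _).mul (IsPolyFun_multilinear _)).mono (by omega)
    refine ⟨fun y => q (y - x0), hqp.translate x0, fun ε hε => ?_⟩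
    have hcont : Continuous (iteratedFDeriv ℝ (m + 1) u) :=
      hu.continuous_iteratedFDeriv (by exact_mod_cast le_rfl)
    obtain ⟨δ, hδ, h⟩ := Metric.continuousAt_iff.1 (hcont.continuousAt (x := x0)) ε hε
    refine ⟨δ, hδ, fun y hy => ?_⟩
    have ht := map_add_eq_sum_add_integral_iteratedFDeriv (f := u) (x := x0) (y := y - x0) (n := m)
      (fun t _ => by exact_mod_cast hu.contDiffAt)
    have e1 : (c * iteratedFDeriv ℝ (m + 1) u x0 (fun _ => y - x0)) =
        (m.factorial : ℝ)⁻¹ * ∫ t in (0 : ℝ)..1, (1 - t) ^ m *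
          iteratedFDeriv ℝ (m + 1) u x0 (fun _ => y - x0) := by
      rw [intervalIntegral.integral_mul_const, hc]; ring
    have e2 : u y - q (y - x0) = (m.factorial : ℝ)⁻¹ * ∫ t in (0 : ℝ)..1, (1 - t) ^ m *
        (iteratedFDeriv ℝ (m + 1) u (x0 + t • (y - x0)) (fun _ => y - x0) -
          iteratedFDeriv ℝ (m + 1) u x0 (fun _ => y - x0)) := by
      rw [add_sub_cancel] at ht
      simp only [smul_eq_mul] at ht
      simp only [mul_sub]
      rw [intervalIntegral.integral_sub, mul_sub, ← e1, ht, hq]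
      · ring
      · apply Continuous.intervalIntegrable
        have : Continuous fun t : ℝ => iteratedFDeriv ℝ (m + 1) u (x0 + t • (y - x0)) :=
          hcont.comp (by fun_prop)
        exact (by fun_prop : Continuous fun t : ℝ => (1 - t) ^ m).mul
          (this.eval_const _)
      · apply Continuous.intervalIntegrable
        fun_prop
    rw [e2, abs_mul, ← Real.norm_eq_abs (intervalIntegral _ _ _ _)]
    have h1 : ‖∫ t in (0 : ℝ)..1, (1 - t) ^ m *
        (iteratedFDeriv ℝ (m + 1) u (x0 + t • (y - x0)) (fun _ => y - x0) -
          iteratedFDeriv ℝ (m + 1) u x0 (fun _ => y - x0))‖ ≤ (ε * ‖y - x0‖ ^ (m + 1)) * |1 - 0| := by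
      refine intervalIntegral.norm_integral_le_of_norm_le_const fun t ht => ?_
      rw [Set.uIoc_of_le zero_le_one] at ht
      rw [norm_mul, norm_pow]
      have h2 : ‖1 - t‖ ^ m ≤ 1 := by
        refine pow_le_one₀ (norm_nonneg _) ?_
        rw [Real.norm_eq_abs, abs_le]
        constructor <;> linarith [ht.1, ht.2]
      have h3 : dist (x0 + t • (y - x0)) x0 < δ := by
        rw [dist_eq_norm, add_sub_cancel_left, norm_smul, Real.norm_eq_abs, abs_of_pos ht.1]
        rw [dist_eq_norm] at hy
        nlinarith [norm_nonneg (y - x0), ht.2, ht.1]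
      have h4 := (h h3).le
      rw [dist_eq_norm] at h4
      have h5 := ContinuousMultilinearMap.le_opNorm
        (iteratedFDeriv ℝ (m + 1) u (x0 + t • (y - x0)) - iteratedFDeriv ℝ (m + 1) u x0)
        (fun _ => y - x0)
      simp only [Finset.prod_const, Finset.card_univ, Fintype.card_fin] at h5
      rw [sub_apply] at h5
      refine (mul_le_mul h2 h5 (norm_nonneg _) zero_le_one).trans ?_
      rw [one_mul]
      gcongr
    have h6 : |(m.factorial : ℝ)⁻¹| ≤ 1 := by
      rw [abs_of_nonneg (by positivity)]
      exact inv_le_one_of_one_le₀ (by exact_mod_cast Nat.succ_le_of_lt m.factorial_pos)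
    refine (mul_le_mul h6 h1 (norm_nonneg _) zero_le_one).trans ?_
    simp

theorem DensityOneAt.mono_local {n : ℕ} {S T : Set (Euc n)} {x : Euc n} (h : DensityOneAt S x)
    {δ : ℝ} (hδ : 0 < δ) (hST : S ∩ ball x δ ⊆ T) : DensityOneAt T x := by
  unfold DensityOneAt at h ⊢
  refine tendsto_of_tendsto_of_tendsto_of_le_of_le' h tendsto_const_nhds ?_ ?_
  · filter_upwards [Ioo_mem_nhdsGT hδ] with r hr
    refine ENNReal.div_le_div_right (measure_mono ?_) _
    rintro y ⟨hy, hy'⟩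
    exact ⟨hST ⟨hy, ball_subset_ball hr.2.le hy'⟩, hy'⟩
  · filter_upwards with r
    exact ENNReal.div_le_of_le_mul (by rw [one_mul]; exact measure_mono Set.inter_subset_right)

theorem ae_densityOneAt {n : ℕ} (hn : 0 < n) (S : Set (Euc n)) :
    ∀ᵐ x ∂(volume.restrict S), DensityOneAt S x := by
  have : Nonempty (Fin n) := ⟨⟨0, hn⟩⟩
  have : Nontrivial (Euc n) := inferInstance
  filter_upwards [Besicovitch.ae_tendsto_measure_inter_div volume S] with x hx
  unfold DensityOneAt
  refine hx.congr fun r => ?_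
  rw [Measure.addHaar_closedBall_eq_addHaar_ball]
  congr 1
  refine measure_congr ?_
  have : ball x r =ᵐ[volume] closedBall x r := by
    refine ae_eq_of_subset_of_measure_ge ball_subset_closedBall
      (Measure.addHaar_closedBall_eq_addHaar_ball _ _ _).le measurableSet_ball.nullMeasurableSet ?_
    exact measure_closedBall_lt_top.ne
  exact (ae_eq_refl S).inter this.symm

theorem dir21 (n : ℕ) (hn : 0 < n) (k : ℕ) (D : Set (Euc n)) (hD : MeasurableSet D)
    (f : Euc n → ℝ) (hf : Measurable (D.restrict f))
    (H : ∀ ε : ℝ, 0 < ε → ∃ u : Euc n → ℝ, ContDiff ℝ k u ∧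
      volume {x | x ∈ D ∧ u x ≠ f x} < ENNReal.ofReal ε) :
    ∀ᵐ x₀ ∂(volume.restrict D), ∃ p : Euc n → ℝ, ApproxDiffAt k D f x₀ p := by
  choose u hu hv using fun j : ℕ => H (1 / (j + 1)) (by positivity)
  have h1 : ∀ᵐ x ∂(volume.restrict D), ∃ j, u j x = f x := by
    rw [ae_restrict_iff' hD, ae_iff]
    refine le_antisymm ?_ zero_le
    have : Tendsto (fun j : ℕ => ENNReal.ofReal (1 / ((j : ℝ) + 1))) atTop (nhds 0) := by
      have := ENNReal.tendsto_ofReal tendsto_one_div_add_atTop_nhds_zero_nat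
      simpa using this
    refine ge_of_tendsto' this fun j => (measure_mono ?_).trans (hv j).le
    intro x hx
    simp only [Set.mem_ofPred_eq, Classical.not_imp, not_exists] at hx
    exact ⟨hx.1, hx.2 j⟩
  have h2 : ∀ j, ∀ᵐ x ∂(volume.restrict D), u j x = f x →
      DensityOneAt {x | x ∈ D ∧ u j x = f x} x := by
    intro j
    have hm : MeasurableSet {x | x ∈ D ∧ u j x = f x} := by
      have : {x | x ∈ D ∧ u j x = f x} = (Subtype.val : D → Euc n) '' {x : D | u j x = D.restrict f x} := by
        ext x; simp only [Set.mem_image, Set.mem_ofPred_eq, Subtype.exists, exists_and_right, exists_eq_right]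
        exact ⟨fun h => ⟨h.1, h.2⟩, fun ⟨a, b⟩ => ⟨a, b⟩⟩
      rw [this]
      exact hD.subtype_image (measurableSet_eq_fun ((hu j).continuous.measurable.comp measurable_subtype_coe) hf)
    have := (ae_restrict_iff' hm).1 (ae_densityOneAt hn {x | x ∈ D ∧ u j x = f x})
    rw [ae_restrict_iff' hD]
    filter_upwards [this] with x hx hxD hxu using hx ⟨hxD, hxu⟩
  filter_upwards [h1, ae_all_iff.2 h2] with x ⟨j, hj⟩ h
  have hd := h j hj
  obtain ⟨p, hp, hpe⟩ := taylor_littleO (hu j) x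
  refine ⟨p, hd.mono_local one_pos fun y hy => hy.1.1, hp, fun ε hε => ?_⟩
  obtain ⟨δ, hδ, h3⟩ := hpe ε hε
  refine DensityOneAt.mono_local hd hδ ?_
  rintro y ⟨⟨hyD, hyu⟩, hyb⟩ ⟨-, hc⟩
  have := h3 y hyb
  rw [hyu] at this
  linarith


theorem volume_ball_pow {n : ℕ} (x : Euc n) {r : ℝ} (hr : 0 < r) :
    volume (ball x r) = ENNReal.ofReal (r ^ n) * volume (ball (0 : Euc n) 1) := by
  rw [Measure.addHaar_ball_of_pos _ _ hr, finrank_euclideanSpace_fin]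

theorem DensityOneAt.compl_small {n : ℕ} {S : Set (Euc n)} {x : Euc n} (hS : MeasurableSet S)
    (h : DensityOneAt S x) {η : ℝ} (hη : 0 < η) :
    ∃ δ : ℝ, 0 < δ ∧ ∀ r, 0 < r → r < δ →
      volume (Sᶜ ∩ ball x r) ≤ ENNReal.ofReal (η * r ^ n) := by
  set v := volume (ball (0 : Euc n) 1) with hv
  have hv0 : v ≠ 0 := (measure_ball_pos _ _ one_pos).ne'
  have hvt : v ≠ ⊤ := measure_ball_lt_top.ne
  set θ : ENNReal := ENNReal.ofReal η / v with hθ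
  have hθ0 : θ ≠ 0 := by
    rw [hθ]; exact ENNReal.div_ne_zero.2 ⟨by simpa using hη, hvt⟩
  have hlt : (1 : ENNReal) - θ < 1 := ENNReal.sub_lt_self ENNReal.one_ne_top one_ne_zero hθ0
  have := (h.eventually (lt_mem_nhds hlt))
  obtain ⟨δ, hδ, hδ'⟩ := (mem_nhdsGT_iff_exists_Ioo_subset).1 this
  refine ⟨δ, hδ, fun r hr hrδ => ?_⟩
  have h1 := hδ' ⟨hr, hrδ⟩
  have hB0 : volume (ball x r) ≠ 0 := (measure_ball_pos _ _ hr).ne'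
  have hBt : volume (ball x r) ≠ ⊤ := measure_ball_lt_top.ne
  have h2 : (1 - θ) * volume (ball x r) ≤ volume (S ∩ ball x r) := by
    have h1' : 1 - θ < volume (S ∩ ball x r) / volume (ball x r) := h1
    exact ((ENNReal.le_div_iff_mul_le (Or.inl hB0) (Or.inl hBt)).1 h1'.le)
  have h3 : volume (S ∩ ball x r) + volume (Sᶜ ∩ ball x r) = volume (ball x r) := by
    rw [Set.inter_comm S, Set.inter_comm Sᶜ, ← Set.sdiff_eq]
    exact measure_inter_add_sdiff _ hS
  have h4 : volume (Sᶜ ∩ ball x r) ≤ θ * volume (ball x r) := by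
    have h5 : volume (ball x r) ≤ (1 - θ) * volume (ball x r) + θ * volume (ball x r) := by
      rw [← add_mul]
      exact le_mul_of_one_le_left' (le_tsub_add)
    have h6 : volume (S ∩ ball x r) ≠ ⊤ := (measure_lt_top_of_subset Set.inter_subset_right hBt).ne
    rw [← h3] at h5
    have h7 : volume (S ∩ ball x r) + volume (Sᶜ ∩ ball x r) ≤
        volume (S ∩ ball x r) + θ * volume (ball x r) := by
      rw [h3] at h5 ⊢
      exact h5.trans (add_le_add h2 le_rfl)
    exact (ENNReal.add_le_add_iff_left h6).1 h7
  refine h4.trans ?_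
  rw [volume_ball_pow x hr, hθ, ← hv, ENNReal.ofReal_mul hη.le, mul_comm (ENNReal.ofReal (r ^ n)),
    ← mul_assoc, ENNReal.div_mul_cancel hv0 hvt]

/-- The bad set. -/
def badSet {n k : ℕ} (D : Set (Euc n)) (g : Euc n → ℝ) (ε : ℝ) (x : Euc n)
    (a : multiIdxLe n k → ℝ) : Set (Euc n) :=
  {y | y ∉ D ∨ ε * ‖y - x‖ ^ k < |g y - Pa a y|}

theorem measurableSet_badSet {n k : ℕ} {D : Set (Euc n)} (hD : MeasurableSet D) {g : Euc n → ℝ}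
    (hg : Measurable g) (ε : ℝ) :
    MeasurableSet {z : (Euc n × (multiIdxLe n k → ℝ)) × Euc n |
      z.2 ∈ badSet D g ε z.1.1 z.1.2} := by
  have h1 : MeasurableSet {z : (Euc n × (multiIdxLe n k → ℝ)) × Euc n | z.2 ∉ D} :=
    (hD.preimage measurable_snd).compl
  have h2 : MeasurableSet {z : (Euc n × (multiIdxLe n k → ℝ)) × Euc n |
      ε * ‖z.2 - z.1.1‖ ^ k < |g z.2 - Pa z.1.2 z.2|} := by
    refine measurableSet_lt ?_ ?_
    · fun_prop
    · have h3 : Measurable fun z : (Euc n × (multiIdxLe n k → ℝ)) × Euc n => Pa z.1.2 z.2 :=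
        (Pa_continuous.comp (by fun_prop :
          Continuous fun z : (Euc n × (multiIdxLe n k → ℝ)) × Euc n => (z.1.2, z.2))).measurable
      exact ((hg.comp measurable_snd).sub h3).abs
  exact h1.union h2

theorem badSet_small {n k : ℕ} {D : Set (Euc n)} (hD : MeasurableSet D) {g : Euc n → ℝ}
    (hg : Measurable g) {f : Euc n → ℝ} (hfg : ∀ x ∈ D, g x = f x) {x : Euc n}
    {a : multiIdxLe n k → ℝ} (h : ApproxDiffAt k D f x (Pa a)) {ε η : ℝ} (hε : 0 < ε) (hη : 0 < η) :
    ∃ δ : ℝ, 0 < δ ∧ ∀ r, 0 < r → r < δ →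
      volume (badSet D g ε x a ∩ ball x r) ≤ ENNReal.ofReal (η * r ^ n) := by
  obtain ⟨h1, -, h2⟩ := h
  have h2 := h2 ε hε
  have e : {y | y ∈ D ∧ ε * ‖y - x‖ ^ k < |f y - Pa a y|} =
      {y | y ∈ D ∧ ε * ‖y - x‖ ^ k < |g y - Pa a y|} := by
    ext y
    simp only [Set.mem_ofPred_eq]
    refine and_congr_right fun hy => ?_
    rw [hfg y hy]
  rw [e] at h2
  have hm : MeasurableSet {y | y ∈ D ∧ ε * ‖y - x‖ ^ k < |g y - Pa a y|} := by
    have h3 : MeasurableSet {y | ε * ‖y - x‖ ^ k < |g y - Pa a y|} :=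
      measurableSet_lt (by fun_prop) (hg.sub (Pa_contDiff a 0).continuous.measurable).abs
    exact hD.inter h3
  obtain ⟨δ1, hδ1, H1⟩ := h1.compl_small hD (half_pos hη)
  obtain ⟨δ2, hδ2, H2⟩ := DensityOneAt.compl_small hm.compl h2 (half_pos hη)
  refine ⟨min δ1 δ2, lt_min hδ1 hδ2, fun r hr hrδ => ?_⟩
  have G1 := H1 r hr (hrδ.trans_le (min_le_left _ _))
  have G2 := H2 r hr (hrδ.trans_le (min_le_right _ _))
  rw [compl_compl] at G2
  have hsub : badSet D g ε x a ∩ ball x r ⊆ (Dᶜ ∩ ball x r) ∪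
      ({y | y ∈ D ∧ ε * ‖y - x‖ ^ k < |g y - Pa a y|} ∩ ball x r) := by
    rintro y ⟨hy, hyb⟩
    by_cases hyD : y ∈ D
    · rcases hy with hy | hy
      · exact absurd hyD hy
      · exact Or.inr ⟨⟨hyD, hy⟩, hyb⟩
    · exact Or.inl ⟨hyD, hyb⟩
  refine (measure_mono hsub).trans ((measure_union_le _ _).trans ((add_le_add G1 G2).trans ?_))
  rw [← ENNReal.ofReal_add (by positivity) (by positivity)]
  exact le_of_eq (by ring_nf)

/-- Pairwise comparison. -/
theorem jet_compare (n k : ℕ) : ∃ η : ℝ, 0 < η ∧ ∃ C : ℝ, 0 < C ∧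
    ∀ (D : Set (Euc n)) (g : Euc n → ℝ) (ε r : ℝ) (x y : Euc n) (a b : multiIdxLe n k → ℝ),
      0 < ε → 0 < r → dist x y ≤ r →
      volume (badSet D g ε x a ∩ ball x r) ≤ ENNReal.ofReal (η * (2 * r) ^ n) →
      volume (badSet D g ε y b ∩ ball y (2 * r)) ≤ ENNReal.ofReal (η * (4 * r) ^ n) →
      (∀ z, dist z x ≤ r → Bd k (fun w => Pa a w - Pa b w) z r (C * ε * r ^ k)) ∧
      ∀ z, |Pa a z - Pa b z| ≤ C * ε * (r + dist z x) ^ k := by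
  obtain ⟨η, hη, C, hC, h⟩ := DG n k
  obtain ⟨s, hs0, hs⟩ := ENNReal.lt_iff_exists_nnreal_btwn.1 hη
  have hs0' : (0 : ℝ) < s := by exact_mod_cast hs0
  refine ⟨s / (2 * 4 ^ n), by positivity, C * (1 + 2 ^ k), by positivity, ?_⟩
  intro D g ε r x y a b hε hr hxy h1 h2
  have hM : 0 ≤ ε * (1 + 2 ^ k) * r ^ k := by positivity
  have hvol : volume {z | z ∈ ball x r ∧ ε * (1 + 2 ^ k) * r ^ k < |Pa a z - Pa b z|} <
      η * ENNReal.ofReal (r ^ n) := by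
    have hsub : {z | z ∈ ball x r ∧ ε * (1 + 2 ^ k) * r ^ k < |Pa a z - Pa b z|} ⊆
        (badSet D g ε x a ∩ ball x r) ∪ (badSet D g ε y b ∩ ball y (2 * r)) := by
      rintro z ⟨hz, hz'⟩
      by_contra hc
      rw [Set.mem_union, not_or] at hc
      obtain ⟨hc1, hc2⟩ := hc
      have hzx : dist z x < r := hz
      have hzy : dist z y < 2 * r := by linarith [dist_triangle z x y]
      have e1 : z ∉ badSet D g ε x a := fun hh => hc1 ⟨hh, hz⟩
      have e2 : z ∉ badSet D g ε y b := fun hh => hc2 ⟨hh, hzy⟩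
      simp only [badSet, Set.mem_ofPred_eq, not_or, not_lt, not_not] at e1 e2
      have e3 : ε * ‖z - x‖ ^ k ≤ ε * r ^ k := by
        rw [← dist_eq_norm]; gcongr
      have e4 : ε * ‖z - y‖ ^ k ≤ ε * (2 * r) ^ k := by
        rw [← dist_eq_norm]; gcongr
      have e5 : |Pa a z - Pa b z| ≤ |g z - Pa a z| + |g z - Pa b z| := by
        rw [show Pa a z - Pa b z = (g z - Pa b z) - (g z - Pa a z) by ring]
        exact (abs_sub _ _).trans (by rw [add_comm])
      rw [mul_pow] at e4
      nlinarith [e1.2, e2.2]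
    refine lt_of_le_of_lt ((measure_mono hsub).trans
      ((measure_union_le _ _).trans (add_le_add h1 h2))) ?_
    rw [← ENNReal.ofReal_add (by positivity) (by positivity)]
    have hr0 : ENNReal.ofReal (r ^ n) ≠ 0 := by
      have : 0 < r ^ n := by positivity
      simpa using this
    have e6 : ENNReal.ofReal (s / (2 * 4 ^ n) * (2 * r) ^ n + s / (2 * 4 ^ n) * (4 * r) ^ n) ≤
        (s : ENNReal) * ENNReal.ofReal (r ^ n) := by
      rw [← ENNReal.ofReal_coe_nnreal, ← ENNReal.ofReal_mul hs0'.le]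
      refine ENNReal.ofReal_le_ofReal ?_
      have h24 : (2 * r) ^ n ≤ (4 * r) ^ n := by gcongr; norm_num
      have : s / (2 * 4 ^ n) * (2 * r) ^ n ≤ s / (2 * 4 ^ n) * (4 * r) ^ n :=
        mul_le_mul_of_nonneg_left h24 (by positivity)
      have e7 : s / (2 * 4 ^ n) * (4 * r) ^ n + s / (2 * 4 ^ n) * (4 * r) ^ n = s * r ^ n := by
        rw [mul_pow]; field_simp; ring
      linarith
    refine e6.trans_lt ?_
    exact (ENNReal.mul_lt_mul_iff_left hr0 ENNReal.ofReal_ne_top).2 hs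
  obtain ⟨c1, c2⟩ := h (fun w => Pa a w - Pa b w) ((IsPolyFun_Pa a).sub (IsPolyFun_Pa b)) x r
    (ε * (1 + 2 ^ k) * r ^ k) hr hM hvol
  refine ⟨fun z hz => (c1 z hz).mono (le_of_eq (by ring)), fun z => (c2 z).trans (le_of_eq ?_)⟩
  have : r + dist z x = r * (1 + dist z x / r) := by field_simp
  rw [this, mul_pow]; ring


/-- Pairs with uniformly small bad sets. -/
def goodSet {n : ℕ} (k : ℕ) (D : Set (Euc n)) (g : Euc n → ℝ) (η : ℝ) (m j : ℕ) :
    Set (Euc n × (multiIdxLe n k → ℝ)) :=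
  {z | ∀ r : ℚ, 0 < (r : ℝ) → (r : ℝ) < 1 / ((j : ℝ) + 1) →
    volume (badSet D g (1 / ((m : ℝ) + 1)) z.1 z.2 ∩ ball z.1 (r : ℝ)) ≤
      ENNReal.ofReal (η * (r : ℝ) ^ n)}

theorem measurableSet_goodSet {n k : ℕ} {D : Set (Euc n)} (hD : MeasurableSet D) {g : Euc n → ℝ}
    (hg : Measurable g) (η : ℝ) (m j : ℕ) : MeasurableSet (goodSet k D g η m j) := by
  have h : ∀ r : ℚ, MeasurableSet {z : Euc n × (multiIdxLe n k → ℝ) |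
      volume (badSet D g (1 / ((m : ℝ) + 1)) z.1 z.2 ∩ ball z.1 (r : ℝ)) ≤
      ENNReal.ofReal (η * (r : ℝ) ^ n)} := by
    intro r
    have h1 : MeasurableSet {z : (Euc n × (multiIdxLe n k → ℝ)) × Euc n |
        z.2 ∈ ball z.1.1 (r : ℝ)} := by
      have : MeasurableSet {z : (Euc n × (multiIdxLe n k → ℝ)) × Euc n | dist z.2 z.1.1 < (r : ℝ)} :=
        measurableSet_lt (by fun_prop) (by fun_prop)
      exact this
    have h2 := (measurableSet_badSet (k := k) hD hg (1 / ((m : ℝ) + 1))).inter h1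
    exact measurableSet_le (measurable_measure_prodMk_left (ν := volume) h2) measurable_const
  have e : goodSet k D g η m j = ⋂ r : ℚ, {z : Euc n × (multiIdxLe n k → ℝ) |
      0 < (r : ℝ) → (r : ℝ) < 1 / ((j : ℝ) + 1) →
      volume (badSet D g (1 / ((m : ℝ) + 1)) z.1 z.2 ∩ ball z.1 (r : ℝ)) ≤
      ENNReal.ofReal (η * (r : ℝ) ^ n)} := by
    ext z; simp only [goodSet, Set.mem_ofPred_eq, Set.mem_iInter]
  rw [e]
  refine MeasurableSet.iInter fun r => ?_
  by_cases h1 : 0 < (r : ℝ)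
  · by_cases h2 : (r : ℝ) < 1 / ((j : ℝ) + 1)
    · simp only [h1, h2, true_imp_iff]
      exact h r
    · simp only [h2, false_imp_iff, imp_true_iff]
      exact MeasurableSet.univ
  · simp only [h1, false_imp_iff]
    exact MeasurableSet.univ

theorem goodSet_mono {n k : ℕ} {D : Set (Euc n)} {g : Euc n → ℝ} {η : ℝ} {m j j' : ℕ}
    (h : j ≤ j') : goodSet k D g η m j ⊆ goodSet k D g η m j' := by
  intro z hz r hr hr'
  refine hz r hr (hr'.trans_le ?_)
  gcongr

theorem goodSet_real {n k : ℕ} {D : Set (Euc n)} {g : Euc n → ℝ} {η : ℝ} (hη : 0 < η) {m j : ℕ}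
    {x : Euc n} {a : multiIdxLe n k → ℝ} (h : (x, a) ∈ goodSet k D g η m j) {r : ℝ} (hr : 0 < r)
    (hrj : r < 1 / ((j : ℝ) + 1)) :
    volume (badSet D g (1 / ((m : ℝ) + 1)) x a ∩ ball x r) ≤ ENNReal.ofReal (η * (2 * r) ^ n) := by
  obtain ⟨q, hq1, hq2⟩ := exists_rat_btwn (lt_min (by linarith : r < 2 * r) hrj)
  have hq0 : 0 < (q : ℝ) := hr.trans hq1
  refine (measure_mono ?_).trans ((h q hq0 (hq2.trans_le (min_le_right _ _))).trans ?_)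
  · exact Set.inter_subset_inter_right _ (ball_subset_ball hq1.le)
  · refine ENNReal.ofReal_le_ofReal ?_
    have := (hq2.trans_le (min_le_left _ _)).le
    gcongr

/-- The graph of the approximate jet. -/
def Gam {n : ℕ} (k : ℕ) (D : Set (Euc n)) (g : Euc n → ℝ) (η : ℝ) :
    Set (Euc n × (multiIdxLe n k → ℝ)) :=
  {z | z.1 ∈ D ∧ g z.1 = Pa z.2 z.1 ∧ ∀ m, ∃ j, z ∈ goodSet k D g η m j}

theorem measurableSet_Gam {n k : ℕ} {D : Set (Euc n)} (hD : MeasurableSet D) {g : Euc n → ℝ}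
    (hg : Measurable g) (η : ℝ) : MeasurableSet (Gam k D g η) := by
  have h1 : MeasurableSet {z : Euc n × (multiIdxLe n k → ℝ) | z.1 ∈ D} := hD.preimage measurable_fst
  have h2 : MeasurableSet {z : Euc n × (multiIdxLe n k → ℝ) | g z.1 = Pa z.2 z.1} :=
    measurableSet_eq_fun (hg.comp measurable_fst) (Pa_continuous.comp (by fun_prop :
          Continuous fun z : Euc n × (multiIdxLe n k → ℝ) => (z.2, z.1))).measurable
  have h3 : MeasurableSet (⋂ m, ⋃ j, goodSet k D g η m j) :=
    MeasurableSet.iInter fun m => MeasurableSet.iUnion fun j => measurableSet_goodSet hD hg η m j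
  have e : Gam k D g η = {z : Euc n × (multiIdxLe n k → ℝ) | z.1 ∈ D} ∩
      ({z : Euc n × (multiIdxLe n k → ℝ) | g z.1 = Pa z.2 z.1} ∩
        ⋂ m, ⋃ j, goodSet k D g η m j) := by
    ext z; simp [Gam]
  rw [e]
  exact h1.inter (h2.inter h3)

/-- The conclusion of the comparison for given constants. -/
def Cmp (n k : ℕ) (η C : ℝ) : Prop :=
    ∀ (D : Set (Euc n)) (g : Euc n → ℝ) (ε r : ℝ) (x y : Euc n) (a b : multiIdxLe n k → ℝ),
      0 < ε → 0 < r → dist x y ≤ r →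
      volume (badSet D g ε x a ∩ ball x r) ≤ ENNReal.ofReal (η * (2 * r) ^ n) →
      volume (badSet D g ε y b ∩ ball y (2 * r)) ≤ ENNReal.ofReal (η * (4 * r) ^ n) →
      (∀ z, dist z x ≤ r → Bd k (fun w => Pa a w - Pa b w) z r (C * ε * r ^ k)) ∧
      ∀ z, |Pa a z - Pa b z| ≤ C * ε * (r + dist z x) ^ k

theorem good_cmp {n k : ℕ} {η C : ℝ} (hη : 0 < η) (hc : Cmp n k η C)
    {D : Set (Euc n)} {g : Euc n → ℝ} {m j : ℕ} {x y : Euc n} {a b : multiIdxLe n k → ℝ}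
    (hx : (x, a) ∈ goodSet k D g η m j) (hy : (y, b) ∈ goodSet k D g η m j) {r : ℝ}
    (hr : 0 < r) (hrj : r < 1 / (2 * ((j : ℝ) + 1))) (hxy : dist x y ≤ r) :
    (∀ z, dist z x ≤ r →
      Bd k (fun w => Pa a w - Pa b w) z r (C * (1 / ((m : ℝ) + 1)) * r ^ k)) ∧
      ∀ z, |Pa a z - Pa b z| ≤ C * (1 / ((m : ℝ) + 1)) * (r + dist z x) ^ k := by
  have h2r : 2 * r < 1 / ((j : ℝ) + 1) := by
    rw [lt_div_iff₀ (by positivity)] at hrj ⊢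
    linarith
  refine hc D g _ r x y a b (by positivity) hr hxy
    (goodSet_real hη hx hr (by linarith)) ?_
  have := goodSet_real hη hy (by positivity : 0 < 2 * r) h2r
  rwa [show 2 * (2 * r) = 4 * r by ring] at this

theorem Gam_unique {n k : ℕ} {η C : ℝ} (hη : 0 < η) (hC : 0 < C) (hc : Cmp n k η C)
    {D : Set (Euc n)} {g : Euc n → ℝ} {x : Euc n} {a b : multiIdxLe n k → ℝ}
    (ha : (x, a) ∈ Gam k D g η) (hb : (x, b) ∈ Gam k D g η) : a = b := by
  have key : ∀ z, |Pa a z - Pa b z| ≤ 0 := by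
    intro z
    have hlim : Tendsto (fun m : ℕ => C * (1 / ((m : ℝ) + 1)) * (1 + dist z x) ^ k) atTop
        (nhds 0) := by
      have := (tendsto_one_div_add_atTop_nhds_zero_nat (𝕜 := ℝ)).const_mul C
      simpa using this.mul_const ((1 + dist z x) ^ k)
    refine ge_of_tendsto' hlim fun m => ?_
    obtain ⟨j1, h1⟩ := ha.2.2 m
    obtain ⟨j2, h2⟩ := hb.2.2 m
    have h1' := goodSet_mono (le_max_left j1 j2) h1
    have h2' := goodSet_mono (le_max_right j1 j2) h2
    have hpos : (0 : ℝ) < 1 / (2 * (((max j1 j2 : ℕ) : ℝ) + 1)) := by positivity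
    have hle1 : 1 / (2 * (((max j1 j2 : ℕ) : ℝ) + 1)) ≤ 1 := by
      rw [div_le_one (by positivity)]
      have : (0 : ℝ) ≤ ((max j1 j2 : ℕ) : ℝ) := Nat.cast_nonneg _
      linarith
    have := (good_cmp hη hc h1' h2' (half_pos hpos) (half_lt_self hpos)
      (by simp only [dist_self]; positivity)).2 z
    refine this.trans ?_
    have hd : 0 ≤ dist z x := dist_nonneg
    gcongr
    linarith
  have h0 : a - b = 0 := by
    refine Pa_inj _ fun z _ => ?_
    rw [Pa_sub]
    exact abs_nonpos_iff.1 (key z)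
  exact sub_eq_zero.1 h0

theorem local_lusin {n k : ℕ} {η C : ℝ} (hη : 0 < η) (hC : 0 < C) (hc : Cmp n k η C)
    {D : Set (Euc n)} (hD : MeasurableSet D) {g : Euc n → ℝ} (hg : Measurable g)
    (hae : volume (D \ Prod.fst '' (Gam k D g η)) = 0)
    {S : Set (Euc n)} (hS : MeasurableSet S) (hSD : S ⊆ D) (hfin : volume S ≠ ⊤)
    {ε : ENNReal} (hε : ε ≠ 0) :
    ∃ (F : Set (Euc n)) (u : Euc n → ℝ), IsCompact F ∧ F ⊆ S ∧ ContDiff ℝ k u ∧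
      (∀ x ∈ F, u x = g x) ∧ volume (S \ F) < ε := by
  set T : ℕ → ℕ → Set (Euc n) := fun m j => Prod.fst '' (Gam k D g η ∩ goodSet k D g η m j) with hT
  have hTm : ∀ m j, MeasurableSet (T m j) := by
    intro m j
    refine MeasurableSet.image_of_measurable_injOn
      ((measurableSet_Gam hD hg η).inter (measurableSet_goodSet hD hg η m j)) measurable_fst ?_
    rintro ⟨x, a⟩ hx ⟨y, b⟩ hy (hxy : x = y)
    subst hxy
    rw [Gam_unique hη hC hc hx.1 hy.1]
  have hlim : ∀ m, Tendsto (fun j => volume (S \ T m j)) atTop (nhds 0) := by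
    intro m
    have h0 : volume (⋂ j, S \ T m j) = 0 := by
      refine measure_mono_null ?_ hae
      intro x hx
      rw [Set.mem_iInter] at hx
      refine ⟨hSD (hx 0).1, ?_⟩
      rintro ⟨z, hz, rfl⟩
      obtain ⟨j, hj⟩ := hz.2.2 m
      exact (hx j).2 ⟨z, ⟨hz, hj⟩, rfl⟩
    have := tendsto_measure_iInter_atTop (μ := volume) (s := fun j => S \ T m j)
      (fun j => (hS.diff (hTm m j)).nullMeasurableSet) ?_ ⟨0, (measure_lt_top_of_subset
        Set.sdiff_subset hfin).ne⟩
    · rw [h0] at this; exact this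
    · intro j j' hj
      refine Set.sdiff_subset_sdiff_right (Set.image_mono ?_)
      exact Set.inter_subset_inter_right _ (goodSet_mono hj)
  have hε2 : ε / 2 ≠ 0 := by simpa using hε
  obtain ⟨δ, hδ, hsum⟩ := ENNReal.exists_pos_sum_of_countable' hε2 ℕ
  have hj : ∀ m, ∃ j, volume (S \ T m j) < δ m := fun m =>
    ((hlim m).eventually (gt_mem_nhds (hδ m))).exists
  choose j hj using hj
  set E : Set (Euc n) := S ∩ ⋂ m, T m (j m) with hE
  have hEm : MeasurableSet E := hS.inter (MeasurableSet.iInter fun m => hTm m _)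
  have hSE : volume (S \ E) < ε / 2 := by
    have : S \ E ⊆ ⋃ m, S \ T m (j m) := by
      rintro x ⟨hx, hx'⟩
      by_contra hcon
      refine hx' ⟨hx, Set.mem_iInter.2 fun m => ?_⟩
      by_contra hcm
      exact hcon (Set.mem_iUnion.2 ⟨m, hx, hcm⟩)
    exact ((measure_mono this).trans ((measure_iUnion_le _).trans
      (ENNReal.tsum_le_tsum fun m => (hj m).le))).trans_lt hsum
  obtain ⟨F, hFE, hF, hEF⟩ := hEm.exists_isCompact_sdiff_lt
    (measure_lt_top_of_subset Set.inter_subset_left hfin).ne hε2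
  have hex : ∀ x ∈ F, ∃ a : multiIdxLe n k → ℝ, (x, a) ∈ Gam k D g η ∧
      ∀ m, (x, a) ∈ goodSet k D g η m (j m) := by
    intro x hx
    have h1 := fun m => Set.mem_iInter.1 (hFE hx).2 m
    have h2 : ∀ m, ∃ a : multiIdxLe n k → ℝ, (x, a) ∈ Gam k D g η ∧
        (x, a) ∈ goodSet k D g η m (j m) := by
      intro m
      obtain ⟨⟨y, a⟩, hz, hzx⟩ := h1 m
      have : y = x := hzx
      subst this
      exact ⟨a, hz⟩
    choose a ha using h2
    refine ⟨a 0, (ha 0).1, fun m => ?_⟩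
    rw [Gam_unique hη hC hc (ha 0).1 (ha m).1]
    exact (ha m).2
  choose! a haG hag using hex
  obtain ⟨u, hu, hue⟩ := whitney n k F hF (fun x => Pa (a x)) (fun x => Pa_contDiff _ k) (by
    intro ε hε
    obtain ⟨m, hm⟩ := exists_nat_one_div_lt (div_pos hε hC)
    refine ⟨1 / (2 * ((j m : ℝ) + 1)), by positivity, fun r hr hrj x hx y hy hxy z hz => ?_⟩
    refine ((good_cmp hη hc (hag x hx m) (hag y hy m) hr hrj hxy).1 z hz).mono ?_
    rw [lt_div_iff₀ hC] at hm
    gcongr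
    linarith)
  refine ⟨F, u, hF, fun x hx => (hFE hx).1, hu, fun x hx => ?_, ?_⟩
  · rw [hue x hx, ← (haG x hx).2.1]
  · have : S \ F ⊆ (S \ E) ∪ (E \ F) := by
      rintro x ⟨h1, h2⟩
      by_cases h3 : x ∈ E
      · exact Or.inr ⟨h3, h2⟩
      · exact Or.inl ⟨h1, h3⟩
    refine (measure_mono this).trans_lt ((measure_union_le _ _).trans_lt ?_)
    calc _ < ε / 2 + ε / 2 := ENNReal.add_lt_add hSE hEF
      _ = ε := ENNReal.add_halves ε


theorem ae_Gam {n : ℕ} (hn : 0 < n) {k : ℕ} {η : ℝ} (hη : 0 < η)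
    {D : Set (Euc n)} (hD : MeasurableSet D) {g : Euc n → ℝ} (hg : Measurable g)
    {f : Euc n → ℝ} (hfg : ∀ x ∈ D, g x = f x)
    (H : ∀ᵐ x₀ ∂(volume.restrict D), ∃ p : Euc n → ℝ, ApproxDiffAt k D f x₀ p) :
    volume (D \ Prod.fst '' (Gam k D g η)) = 0 := by
  have hm : ∀ q : ℚ × ℚ, MeasurableSet (D ∩ g ⁻¹' (Set.Ioo (q.1 : ℝ) (q.2 : ℝ))) := fun q =>
    hD.inter (hg measurableSet_Ioo)
  have h1 : ∀ q : ℚ × ℚ, ∀ᵐ x ∂(volume : Measure (Euc n)),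
      x ∈ D ∩ g ⁻¹' (Set.Ioo (q.1 : ℝ) (q.2 : ℝ)) →
      DensityOneAt (D ∩ g ⁻¹' (Set.Ioo (q.1 : ℝ) (q.2 : ℝ))) x := fun q =>
    (ae_restrict_iff' (hm q)).1 (ae_densityOneAt hn _)
  have h2 := (ae_restrict_iff' hD).1 H
  have key : ∀ᵐ x ∂(volume : Measure (Euc n)), x ∈ D → x ∈ Prod.fst '' (Gam k D g η) := by
    filter_upwards [ae_all_iff.2 h1, h2] with x hx1 hx2 hxD
    obtain ⟨p, hp⟩ := hx2 hxD
    obtain ⟨a, rfl⟩ := hp.2.1.exists_Pa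
    refine ⟨(x, a), ⟨hxD, ?_, fun m => ?_⟩, rfl⟩
    · show g x = Pa a x
      by_contra hne
      set d := |g x - Pa a x| with hd
      have hd0 : 0 < d := abs_pos.2 (sub_ne_zero.2 hne)
      obtain ⟨q1, hq1, hq1'⟩ := exists_rat_btwn (by linarith : g x - d / 4 < g x)
      obtain ⟨q2, hq2, hq2'⟩ := exists_rat_btwn (by linarith : g x < g x + d / 4)
      have hdens := hx1 (q1, q2) ⟨hxD, hq1', hq2⟩
      set v := volume (ball (0 : Euc n) 1) with hv
      have hv0 : v ≠ 0 := (measure_ball_pos _ _ one_pos).ne'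
      have hvt : v ≠ ⊤ := measure_ball_lt_top.ne
      have hvr : 0 < v.toReal := ENNReal.toReal_pos hv0 hvt
      obtain ⟨δ1, hδ1, H1⟩ := hdens.compl_small (hm (q1, q2)) (by positivity : 0 < v.toReal / 4)
      obtain ⟨δ2, hδ2, H2⟩ := badSet_small hD hg hfg hp (by positivity : 0 < d / 4)
        (by positivity : 0 < v.toReal / 4)
      obtain ⟨δ3, hδ3, H3⟩ := Metric.continuousAt_iff.1
        ((Pa_contDiff a 0).continuous.continuousAt (x := x)) (d / 4) (by positivity)
      obtain ⟨r, hr0, hr⟩ := exists_between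
        (lt_min (lt_min hδ1 hδ2) (lt_min hδ3 (one_pos : (0 : ℝ) < 1)))
      have hr1 := hr.trans_le ((min_le_left _ _).trans (min_le_left _ _))
      have hr2 := hr.trans_le ((min_le_left _ _).trans (min_le_right _ _))
      have hr3 := hr.trans_le ((min_le_right _ _).trans (min_le_left _ _))
      have hr4 := hr.trans_le ((min_le_right _ _).trans (min_le_right _ _))
      have hsub : ball x r ⊆ ((D ∩ g ⁻¹' (Set.Ioo (q1 : ℝ) (q2 : ℝ)))ᶜ ∩ ball x r) ∪
          (badSet D g (d / 4) x a ∩ ball x r) := by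
        intro y hy
        by_cases hyS : y ∈ D ∩ g ⁻¹' (Set.Ioo (q1 : ℝ) (q2 : ℝ))
        · refine Or.inr ⟨Or.inr ?_, hy⟩
          have hyx : dist y x < r := hy
          have c1 := H3 (hyx.trans hr3)
          rw [Real.dist_eq] at c1
          have c2 : ‖y - x‖ ^ k ≤ 1 := by
            rw [← dist_eq_norm]
            exact pow_le_one₀ dist_nonneg (hyx.trans hr4).le
          have c3 : q1 < g y := hyS.2.1
          have c4 : g y < q2 := hyS.2.2
          have c5 : |g y - g x| < d / 4 := by
            rw [abs_lt]; constructor <;> linarith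
          have c6 : d ≤ |g y - g x| + |g y - Pa a y| + |Pa a y - Pa a x| := by
            rw [hd]
            have e : g x - Pa a x = -(g y - g x) + (g y - Pa a y) + (Pa a y - Pa a x) := by ring
            rw [e]
            refine (abs_add_three _ _ _).trans ?_
            rw [abs_neg]
          nlinarith
        · exact Or.inl ⟨hyS, hy⟩
      have hcon := (measure_mono hsub).trans ((measure_union_le _ _).trans
        (add_le_add (H1 r hr0 hr1) (H2 r hr0 hr2)))
      rw [volume_ball_pow x hr0, ← hv, ← ENNReal.ofReal_add (by positivity) (by positivity),
        ← ENNReal.ofReal_toReal hvt, ← ENNReal.ofReal_mul (by positivity),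
        ENNReal.ofReal_le_ofReal_iff (by positivity)] at hcon
      have : 0 < r ^ n := by positivity
      rw [ENNReal.toReal_ofReal hvr.le] at hcon
      nlinarith
    · obtain ⟨δ, hδ, hb⟩ := badSet_small hD hg hfg hp (by positivity : 0 < 1 / ((m : ℝ) + 1)) hη
      obtain ⟨j, hj⟩ := exists_nat_one_div_lt hδ
      exact ⟨j, fun r hr hrj => hb r hr (hrj.trans hj)⟩
  rw [ae_iff] at key
  refine measure_mono_null ?_ key
  rintro x ⟨h3, h4⟩ h5
  exact h4 (h5 h3)

open scoped Manifold in
theorem glue {n k : ℕ} (g : Euc n → ℝ) (F : ℕ → Set (Euc n)) (u : ℕ → Euc n → ℝ)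
    (hF : ∀ i, IsCompact (F i)) (hFs : ∀ i, F i ⊆ {x | (i : ℝ) < ‖x‖ ∧ ‖x‖ < i + 1})
    (hu : ∀ i, ContDiff ℝ k (u i)) (hue : ∀ i, ∀ x ∈ F i, u i x = g x) :
    ∃ w : Euc n → ℝ, ContDiff ℝ k w ∧ ∀ i, ∀ x ∈ F i, w x = g x := by
  classical
  have huniq : ∀ i i' : ℕ, ∀ x : Euc n, ((i : ℝ) < ‖x‖ ∧ ‖x‖ < i + 1) →
      ((i' : ℝ) ≤ ‖x‖ ∧ ‖x‖ < i' + 1) → i = i' := by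
    intro i i' x h h'
    have h1 : (i : ℝ) < i' + 1 := by linarith [h.1, h'.2]
    have h2 : (i' : ℝ) < i + 1 := by linarith [h.2, h'.1]
    have h1' : i < i' + 1 := by exact_mod_cast h1
    have h2' : i' < i + 1 := by exact_mod_cast h2
    omega
  have := exists_contMDiffMap_forall_mem_convex_of_local (n := (k : ℕ∞)) (𝓘(ℝ, Euc n))
    (M := Euc n) (F := ℝ)
    (t := fun x => {s | ∀ i, x ∈ F i → s = g x}) ?_ ?_
  · obtain ⟨w, hw⟩ := this
    exact ⟨w, contMDiff_iff_contDiff.1 w.contMDiff, fun i x hx => hw x i hx⟩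
  · intro x s hs t ht a b _ _ hab i hi
    rw [hs i hi, ht i hi, ← add_smul, hab, one_smul]
  · intro x
    set i := ⌊‖x‖⌋₊ with hi
    have hi1 : (i : ℝ) ≤ ‖x‖ := Nat.floor_le (norm_nonneg _)
    have hi2 : ‖x‖ < i + 1 := Nat.lt_floor_add_one _
    rcases hi1.lt_or_eq with hlt | heq
    · refine ⟨{y | (i : ℝ) < ‖y‖ ∧ ‖y‖ < i + 1}, ?_, u i, ?_, ?_⟩
      · refine IsOpen.mem_nhds ?_ ⟨hlt, hi2⟩
        exact (isOpen_lt continuous_const continuous_norm).inter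
          (isOpen_lt continuous_norm continuous_const)
      · exact (contMDiff_iff_contDiff.2 (hu i)).contMDiffOn
      · intro y hy i' hy'
        have : i' = i := huniq i' i y (hFs i' hy') ⟨hy.1.le, hy.2⟩
        subst this
        exact hue _ y hy'
    · refine ⟨{y | y ∉ F i ∧ y ∉ F (i - 1) ∧ (i : ℝ) - 1 < ‖y‖ ∧ ‖y‖ < i + 1}, ?_,
        fun _ => 0, contMDiffOn_const, ?_⟩
      · have hx : ∀ i', x ∉ F i' := by
          intro i' hx
          have h1 := hFs i' hx
          have h3 := huniq i' i x h1 ⟨hi1, hi2⟩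
          subst h3
          linarith [h1.1]
        refine IsOpen.mem_nhds ?_ ⟨hx _, hx _, by linarith, hi2⟩
        exact (hF _).isClosed.isOpen_compl.inter ((hF _).isClosed.isOpen_compl.inter
          ((isOpen_lt continuous_const continuous_norm).inter
          (isOpen_lt continuous_norm continuous_const)))
      · rintro y ⟨h1, h2, h3, h4⟩ i' hy
        exfalso
        have h5 := hFs i' hy
        have h6 : (i : ℝ) < i' + 2 := by linarith [h5.2]
        have h7 : (i' : ℝ) < i + 1 := by linarith [h5.1]
        have h6' : i < i' + 2 := by exact_mod_cast h6
        have h7' : i' < i + 1 := by exact_mod_cast h7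
        have : i' = i ∨ i' = i - 1 := by omega
        rcases this with rfl | rfl
        · exact h1 hy
        · exact h2 hy

theorem dir12 (n : ℕ) (hn : 0 < n) (k : ℕ) (D : Set (Euc n)) (hD : MeasurableSet D)
    (f : Euc n → ℝ) (hf : Measurable (D.restrict f))
    (H : ∀ᵐ x₀ ∂(volume.restrict D), ∃ p : Euc n → ℝ, ApproxDiffAt k D f x₀ p) :
    ∀ ε : ℝ, 0 < ε → ∃ u : Euc n → ℝ, ContDiff ℝ k u ∧
      volume {x | x ∈ D ∧ u x ≠ f x} < ENNReal.ofReal ε := by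
  classical
  intro ε hε
  have : Nonempty (Fin n) := ⟨⟨0, hn⟩⟩
  have : Nontrivial (Euc n) := inferInstance
  set g : Euc n → ℝ := D.indicator f with hgdef
  have hfg : ∀ x ∈ D, g x = f x := fun x hx => Set.indicator_of_mem hx f
  have hg : Measurable g := by
    refine measurable_of_restrict_of_restrict_compl hD ?_ ?_
    · have : D.domRestrict g = D.restrict f := by
        funext x; exact hfg x x.2
      rw [this]; exact hf
    · have : Dᶜ.domRestrict g = fun _ => 0 := by
        funext x; exact Set.indicator_of_notMem x.2 f
      rw [this]; exact measurable_const
  obtain ⟨η, hη, C, hC, hc⟩ := jet_compare n k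
  have hae := ae_Gam hn hη hD hg hfg H
  obtain ⟨δ, hδ, hsum⟩ := ENNReal.exists_pos_sum_of_countable'
    (ε := ENNReal.ofReal ε) (by simpa using hε) ℕ
  set S : ℕ → Set (Euc n) := fun i => D ∩ {x | (i : ℝ) < ‖x‖ ∧ ‖x‖ < i + 1} with hS
  have hSm : ∀ i, MeasurableSet (S i) := fun i =>
    hD.inter ((measurableSet_lt measurable_const measurable_norm).inter
      (measurableSet_lt measurable_norm measurable_const))
  have hSfin : ∀ i, volume (S i) ≠ ⊤ := by
    intro i
    have : S i ⊆ ball 0 ((i : ℝ) + 1) := by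
      rintro x ⟨-, -, hx⟩
      simpa using hx
    exact (measure_lt_top_of_subset this measure_ball_lt_top.ne).ne
  choose F u hF hFS hu hue hv using fun i => local_lusin hη hC hc hD hg hae (hSm i)
    Set.inter_subset_left (hSfin i) (hδ i).ne'
  obtain ⟨w, hw, hwe⟩ := glue g F u hF (fun i => (hFS i).trans Set.inter_subset_right) hu hue
  refine ⟨w, hw, ?_⟩
  have hsub : {x | x ∈ D ∧ w x ≠ f x} ⊆ (⋃ i : ℕ, S i \ F i) ∪ ⋃ i : ℕ, sphere (0 : Euc n) (i : ℝ) := by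
    rintro x ⟨hxD, hx⟩
    have hi1 : ((⌊‖x‖⌋₊ : ℕ) : ℝ) ≤ ‖x‖ := Nat.floor_le (norm_nonneg _)
    have hi2 : ‖x‖ < (⌊‖x‖⌋₊ : ℕ) + 1 := Nat.lt_floor_add_one _
    rcases hi1.lt_or_eq with hlt | heq
    · refine Or.inl (Set.mem_iUnion.2 ⟨⌊‖x‖⌋₊, ⟨hxD, hlt, hi2⟩, fun hxF => hx ?_⟩)
      rw [hwe _ x hxF, hfg x hxD]
    · refine Or.inr (Set.mem_iUnion.2 ⟨⌊‖x‖⌋₊, ?_⟩)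
      rw [mem_sphere_zero_iff_norm]
      exact heq.symm
  have hnull : volume (⋃ i : ℕ, sphere (0 : Euc n) (i : ℝ)) = 0 :=
    measure_iUnion_null fun i => Measure.addHaar_sphere _ _ _
  refine (measure_mono hsub).trans_lt ((measure_union_le _ _).trans_lt ?_)
  rw [hnull, add_zero]
  exact ((measure_iUnion_le _).trans (ENNReal.tsum_le_tsum fun i => (hv i).le)).trans_lt hsum

/-- **Theorem 1.1** (abelian case). `f : D → ℝ` is `k`-approximately differentiable
almost everywhere on `D` iff `f` admits a Lusin approximation by `C^k` functions. -/
theorem stmt0 (n : ℕ) (hn : 0 < n) (k : ℕ) (D : Set (Euc n)) (hD : MeasurableSet D)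
    (f : Euc n → ℝ) (hf : Measurable (D.restrict f)) :
    (∀ᵐ x₀ ∂(volume.restrict D), ∃ p : Euc n → ℝ, ApproxDiffAt k D f x₀ p) ↔
    (∀ ε : ℝ, 0 < ε → ∃ u : Euc n → ℝ, ContDiff ℝ k u ∧
      volume {x | x ∈ D ∧ u x ≠ f x} < ENNReal.ofReal ε) := by
  exact ⟨dir12 n hn k D hD f hf, dir21 n hn k D hD f hf⟩
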